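/- arXiv:1802.03196 — 2 statements merged into one kernel-verified Lean document; each statement's English description precedes it below -/
import Mathlib

section
/- Let Ω be a germ at a point x₀ of a differential 2-form of rank 4 on a 4-dimensional manifold which is of type 3. Then there exist a local coordinate system (x¹,x²,x³,x⁴) centred at x₀ and a smooth function f with f(0) = 0 such that Ω = exp(f)·( exp((1+x¹)x³) dx¹∧dx² + dx³∧dx⁴ ). -/
/-!  Coordinate formalization of differential forms in four variables,
     following "The equivalence problem of differential 2-forms in 4 variables". -/

open Real Filter

/-- Points of `ℝ⁴`; the coordinates `x¹, x², x³, x⁴` of the paper are `x 0, x 1, x 2, x 3`. -/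
abbrev Pt := Fin 4 → ℝ

/-- Partial derivative `∂f/∂xⁱ`. -/
noncomputable def pd (i : Fin 4) (f : Pt → ℝ) (x : Pt) : ℝ :=
  fderiv ℝ f x (Pi.single i 1)

/-- Second partial derivative `∂²f/∂xⁱ∂xʲ`. -/
noncomputable def pd2 (i j : Fin 4) (f : Pt → ℝ) (x : Pt) : ℝ :=
  pd i (fun y => pd j f y) x

/-- Differential forms of degree 0,1,2,3,4 on `ℝ⁴`, given by their (skew-symmetric)
    coordinate components, and vector fields. -/
abbrev Form0 := Pt → ℝ
abbrev Form1 := Pt → Fin 4 → ℝ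
abbrev Form2 := Pt → Fin 4 → Fin 4 → ℝ
abbrev Form3 := Pt → Fin 4 → Fin 4 → Fin 4 → ℝ
abbrev Form4 := Pt → Fin 4 → Fin 4 → Fin 4 → Fin 4 → ℝ
abbrev Vec := Pt → Fin 4 → ℝ

/-- A 2-form has skew-symmetric components. -/
def Alt2 (B : Form2) : Prop := ∀ x i j, B x i j = - B x j i

/-- Exterior derivative of a function. -/
noncomputable def d0 (f : Form0) : Form1 := fun x i => pd i f x

/-- Exterior derivative of a 1-form. -/
noncomputable def d1 (ω : Form1) : Form2 := fun x i j =>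
  pd i (fun y => ω y j) x - pd j (fun y => ω y i) x

/-- Exterior derivative of a 2-form. -/
noncomputable def d2 (B : Form2) : Form3 := fun x i j k =>
  pd i (fun y => B y j k) x - pd j (fun y => B y i k) x + pd k (fun y => B y i j) x

/-- Wedge product of two 1-forms. -/
def w11 (ω η : Form1) : Form2 := fun x i j => ω x i * η x j - ω x j * η x i

/-- Wedge product of a 1-form and a 2-form. -/
def w12 (ω : Form1) (B : Form2) : Form3 := fun x i j k =>
  ω x i * B x j k - ω x j * B x i k + ω x k * B x i j

/-- Wedge product of a 1-form and a 3-form. -/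
def w13 (ω : Form1) (C : Form3) : Form4 := fun x i j k l =>
  ω x i * C x j k l - ω x j * C x i k l + ω x k * C x i j l - ω x l * C x i j k

/-- Wedge product of two 2-forms. -/
def w22 (A B : Form2) : Form4 := fun x i j k l =>
  A x i j * B x k l - A x i k * B x j l + A x i l * B x j k
    + A x j k * B x i l - A x j l * B x i k + A x k l * B x i j

/-- A 2-form is of rank 4 when `Ω ∧ Ω` vanishes nowhere. -/
def Rank4 (B : Form2) : Prop := ∀ x, w22 B B x ≠ 0

/-- Interior products `i_X`. -/
def i1 (X : Vec) (ω : Form1) : Form0 := fun x => ∑ i, X x i * ω x i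
def i2 (X : Vec) (B : Form2) : Form1 := fun x j => ∑ i, X x i * B x i j
def i3 (X : Vec) (C : Form3) : Form2 := fun x j k => ∑ i, X x i * C x i j k
def i4 (X : Vec) (D : Form4) : Form3 := fun x j k l => ∑ i, X x i * D x i j k l

/-- Evaluation `B(X,Y)` of a 2-form on two vector fields. -/
def ev2 (B : Form2) (X Y : Vec) : Form0 := fun x => ∑ i, ∑ j, X x i * Y x j * B x i j

/-- Evaluation `D(X,Y,Z,W)` of a 4-form on four vector fields. -/
def ev4 (D : Form4) (X Y Z W : Vec) : Form0 := fun x =>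
  ∑ i, ∑ j, ∑ k, ∑ l, X x i * Y x j * Z x k * W x l * D x i j k l

/-- Lie derivative of a 1-form (Cartan's magic formula). -/
noncomputable def lie1 (X : Vec) (ω : Form1) : Form1 := fun x i =>
  d0 (i1 X ω) x i + i2 X (d1 ω) x i

/-- Lie derivative of a 2-form (Cartan's magic formula). -/
noncomputable def lie2 (X : Vec) (B : Form2) : Form2 := fun x i j =>
  d1 (i2 X B) x i j + i3 X (d2 B) x i j

/-- Lie bracket of two vector fields. -/
noncomputable def bracket (X Y : Vec) : Vec := fun x i =>
  ∑ j, (X x j * pd j (fun y => Y y i) x - Y x j * pd j (fun y => X y i) x)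

/-- Derivative `X(f)` of a function along a vector field. -/
noncomputable def dirDeriv (X : Vec) (f : Form0) : Form0 := fun x => ∑ j, X x j * pd j f x

/-- Pullback of a 1-form under a smooth map. -/
noncomputable def pull1 (φ : Pt → Pt) (ω : Form1) : Form1 := fun x i =>
  ∑ a, ω (φ x) a * pd i (fun y => φ y a) x

/-- Pullback of a 2-form under a smooth map. -/
noncomputable def pull2 (φ : Pt → Pt) (B : Form2) : Form2 := fun x i j =>
  ∑ a, ∑ b, B (φ x) a b * pd i (fun y => φ y a) x * pd j (fun y => φ y b) x

/-- A pair of mutually inverse smooth maps: a diffeomorphism of `ℝ⁴` (with inverse). -/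
def IsDiffeo (φ ψ : Pt → Pt) : Prop :=
  ContDiff ℝ (⊤ : ℕ∞) φ ∧ ContDiff ℝ (⊤ : ℕ∞) ψ ∧ (∀ x, ψ (φ x) = x) ∧ (∀ x, φ (ψ x) = x)

/-- The covector with components `c` as a linear functional on the tangent space `ℝ⁴`. -/
noncomputable def covec (c : Fin 4 → ℝ) : Pt →ₗ[ℝ] ℝ :=
  ∑ i, c i • (LinearMap.proj i : Pt →ₗ[ℝ] ℝ)

/-- The class of a 1-form `ω` at `x`: the codimension of the space of tangent vectors `v`
    with `i_v ω = 0` and `i_v (dω) = 0`. -/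
noncomputable def classAt (ω : Form1) (x : Pt) : ℕ :=
  4 - Module.finrank ℝ
    ↥(LinearMap.ker (covec (ω x)) ⊓ ⨅ j, LinearMap.ker (covec (fun i => d1 ω x i j)))

/-- Components of the constant 2-form `dxᵃ ∧ dxᵇ`. -/
def dxw (a b : Fin 4) : Fin 4 → Fin 4 → ℝ := fun i j =>
  (if i = a ∧ j = b then (1:ℝ) else 0) - (if i = b ∧ j = a then (1:ℝ) else 0)

/-- A germ of 2-form (with associated 1-form `ω = ω_Ω`) is of type `t` at `x₀`:
    `ω` is nonsingular at `x₀` and of constant class `t` near `x₀`. -/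
def IsTypeAt (ω : Form1) (t : ℕ) (x₀ : Pt) : Prop :=
  ω x₀ ≠ 0 ∧ ∀ᶠ x in nhds x₀, classAt ω x = t


section Helpers
open Topology
open scoped ContDiff


section Nem
variable {K : Type} [TopologicalSpace K] [CompactSpace K]
  {E F : Type} [NormedAddCommGroup E] [NormedSpace ℝ E] [NormedAddCommGroup F] [NormedSpace ℝ F]

/-- Superposition (Nemytskii) operator. -/
def nem (g : C(E, F)) (γ : C(K, E)) : C(K, F) := g.comp γ

/-- Pointwise application as a bounded bilinear map. -/
noncomputable def ptApp : C(K, E →L[ℝ] F) →L[ℝ] C(K, E) →L[ℝ] C(K, F) :=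
  LinearMap.mkContinuous₂
    (LinearMap.mk₂ ℝ (fun (A : C(K, E →L[ℝ] F)) (h : C(K, E)) =>
        (⟨fun t => A t (h t), by fun_prop⟩ : C(K, F)))
      (fun _ _ _ => by ext; simp) (fun _ _ _ => by ext; simp)
      (fun _ _ _ => by ext; simp) (fun _ _ _ => by ext; simp))
    1 (fun A h => by
      rw [ContinuousMap.norm_le _ (by positivity)]
      intro t
      simp only [LinearMap.mk₂_apply, ContinuousMap.coe_mk, one_mul]
      exact ((A t).le_opNorm _).trans
        (mul_le_mul (A.norm_coe_le_norm t) (h.norm_coe_le_norm t) (norm_nonneg _) (norm_nonneg A)))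

@[simp] lemma ptApp_apply (A : C(K, E →L[ℝ] F)) (h : C(K, E)) (t : K) :
    ptApp A h t = A t (h t) := rfl

lemma nem_hasFDerivAt (g : E → F) (g' : E → E →L[ℝ] F) (hg : Continuous g) (hg' : Continuous g')
    (hd : ∀ x, HasFDerivAt g (g' x) x) (γ : C(K, E)) :
    HasFDerivAt (nem (K := K) ⟨g, hg⟩) (ptApp (nem ⟨g', hg'⟩ γ)) γ := by
  rw [hasFDerivAt_iff_isLittleO_nhds_zero, Asymptotics.isLittleO_iff]
  intro c hc
  have hcont : Continuous (nem (K := K) ⟨g', hg'⟩) := ContinuousMap.continuous_postcomp _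
  obtain ⟨δ, hδ, h⟩ := Metric.continuous_iff.1 hcont γ c hc
  filter_upwards [Metric.ball_mem_nhds (0 : C(K, E)) hδ] with h' hh'
  rw [ContinuousMap.norm_le _ (by positivity)]
  intro t
  have hseg : ∀ x ∈ segment ℝ (γ t) (γ t + h' t), ‖g' x - g' (γ t)‖ ≤ c := by
    intro x hx
    rw [segment_eq_image'] at hx
    obtain ⟨s, hs, rfl⟩ := hx
    have h1 : dist (γ + s • h') γ < δ := by
      rw [dist_eq_norm, add_sub_cancel_left, norm_smul, Real.norm_of_nonneg hs.1]
      have : ‖h'‖ < δ := by simpa using hh'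
      nlinarith [norm_nonneg h', hs.2]
    have h2 := (h _ h1).le
    rw [dist_eq_norm] at h2
    have h3 := (ContinuousMap.norm_coe_le_norm (nem ⟨g', hg'⟩ (γ + s • h') - nem ⟨g', hg'⟩ γ) t).trans h2
    simpa [nem] using h3
  have := (convex_segment (γ t) (γ t + h' t)).norm_image_sub_le_of_norm_hasFDerivWithin_le'
    (f := g) (f' := g') (φ := g' (γ t)) (C := c) (fun x hx => (hd x).hasFDerivWithinAt) hseg
    (left_mem_segment ℝ _ _) (right_mem_segment ℝ _ _)
  simp only [add_sub_cancel_left] at this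
  refine (le_trans ?_ this).trans (mul_le_mul_of_nonneg_left (h'.norm_coe_le_norm t) hc.le)
  simp [nem]

lemma nem_contDiff_nat (n : ℕ) : ∀ {F : Type} [NormedAddCommGroup F] [NormedSpace ℝ F]
    (g : E → F) (hg : ContDiff ℝ ∞ g), ContDiff ℝ n (nem (K := K) ⟨g, hg.continuous⟩) := by
  induction n with
  | zero =>
    intro F _ _ g hg
    exact contDiff_zero.2 (ContinuousMap.continuous_postcomp _)
  | succ n ih =>
    intro F _ _ g hg
    have hg1 : ContDiff ℝ ∞ (fderiv ℝ g) := hg.fderiv_right (by simp)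
    have := contDiff_succ_iff_hasFDerivAt (𝕜 := ℝ) (n := n) (f := nem (K := K) ⟨g, hg.continuous⟩)
    push_cast
    rw [this]
    refine ⟨fun γ => ptApp (nem ⟨fderiv ℝ g, hg1.continuous⟩ γ), ?_, fun γ => ?_⟩
    · exact (ptApp (K := K) (E := E) (F := F)).contDiff.comp (ih _ hg1)
    · exact nem_hasFDerivAt g _ _ _ (fun x => (hg.differentiable (by simp) x).hasFDerivAt) γ

lemma nem_contDiff (g : E → F) (hg : ContDiff ℝ ∞ g) :
    ContDiff ℝ ∞ (nem (K := K) ⟨g, hg.continuous⟩) :=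
  contDiff_infty.2 fun n => nem_contDiff_nat n g hg

end Nem


section Cut
variable {E F G : Type} [NormedAddCommGroup E] [NormedSpace ℝ E] 
  [NormedAddCommGroup F] [NormedSpace ℝ F] [NormedAddCommGroup G] [NormedSpace ℝ G]

lemma cutoff [FiniteDimensional ℝ E] (g : E → F) (W : Set E) (hW : IsOpen W) (x₀ : E) (hx : x₀ ∈ W)
    (hg : ContDiffOn ℝ ∞ g W) : ∃ g' : E → F, ContDiff ℝ ∞ g' ∧ ∀ᶠ x in 𝓝 x₀, g' x = g x := by
  obtain ⟨ε, hε, hb⟩ := Metric.isOpen_iff.1 hW x₀ hx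
  let b : ContDiffBump x₀ := ⟨ε / 4, ε / 2, by linarith, by linarith⟩
  refine ⟨fun x => b x • g x, ?_, ?_⟩
  · rw [contDiff_iff_contDiffAt]
    intro x
    by_cases hxe : x ∈ Metric.ball x₀ ε
    · exact b.contDiff.contDiffAt.smul (hg.contDiffAt (hW.mem_nhds (hb hxe)))
    · have : (fun x => b x • g x) =ᶠ[𝓝 x] fun _ => 0 := by
        have h1 : (Metric.closedBall x₀ (ε / 2))ᶜ ∈ 𝓝 x := by
          refine Metric.isClosed_closedBall.isOpen_compl.mem_nhds ?_
          simp only [Metric.mem_ball, not_lt, Set.mem_compl_iff, Metric.mem_closedBall, not_le] at *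
          linarith
        filter_upwards [h1] with y hy
        have : b y = 0 := by
          apply b.zero_of_le_dist
          simp only [Set.mem_compl_iff, Metric.mem_closedBall, not_le] at hy
          exact hy.le
        simp [this]
      exact contDiffAt_const.congr_of_eventuallyEq this
  · filter_upwards [b.eventuallyEq_one] with x hx
    simp [hx]

/-- Inverse function theorem, smooth on a neighbourhood. -/
lemma invfun [CompleteSpace E] (f : E → F) (hf : ContDiff ℝ ∞ f) (a : E) (f' : E ≃L[ℝ] F)
    (hf' : HasFDerivAt f (f' : E →L[ℝ] F) a) :
    ∃ (e : OpenPartialHomeomorph E F), (⇑e = f) ∧ a ∈ e.source ∧ ContDiffOn ℝ ∞ e.symm e.target := by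
  let e0 := hf.contDiffAt.toOpenPartialHomeomorph f hf' (by simp)
  have ha : a ∈ e0.source := hf.contDiffAt.mem_toOpenPartialHomeomorph_source hf' (by simp)
  have hc : ContinuousAt (fderiv ℝ f) a := (hf.continuous_fderiv (by simp)).continuousAt
  have hS : {x | ∃ A : E ≃L[ℝ] F, (A : E →L[ℝ] F) = fderiv ℝ f x} ∈ 𝓝 a := by
    have := ContinuousLinearEquiv.nhds f'
    rw [← hf'.fderiv] at this
    filter_upwards [hc this] with x hx
    exact hx
  obtain ⟨S, hSs, hSo, haS⟩ := mem_nhds_iff.1 hS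
  refine ⟨e0.restrOpen S hSo, rfl, ⟨ha, haS⟩, fun y hy => ContDiffAt.contDiffWithinAt ?_⟩
  have hys := (e0.restrOpen S hSo).map_target hy
  obtain ⟨A, hA⟩ := hSs hys.2
  refine OpenPartialHomeomorph.contDiffAt_symm _ hy (f₀' := A) ?_ hf.contDiffAt
  rw [hA]
  exact (hf.differentiable (by simp) _).hasFDerivAt

/-- Germ version in finite dimension. -/
lemma invgerm [FiniteDimensional ℝ E] [FiniteDimensional ℝ F] (f : E → F) (hf : ContDiff ℝ ∞ f)
    (a : E) (f' : E ≃L[ℝ] F)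
    (hf' : HasFDerivAt f (f' : E →L[ℝ] F) a) :
    ∃ g : F → E, ContDiff ℝ ∞ g ∧ g (f a) = a ∧ (∀ᶠ x in 𝓝 a, g (f x) = x) ∧
      (∀ᶠ y in 𝓝 (f a), f (g y) = y) := by
  have : CompleteSpace E := FiniteDimensional.complete ℝ E
  obtain ⟨e, rfl, ha, hs⟩ := invfun f hf a f' hf'
  obtain ⟨g, hg, hge⟩ := cutoff e.symm e.target e.open_target (e a) (e.map_source ha) hs
  refine ⟨g, hg, ?_, ?_, ?_⟩
  · rw [hge.self_of_nhds, e.left_inv ha]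
  · filter_upwards [(e.continuousAt ha).eventually hge, e.open_source.mem_nhds ha] with x h1 h2
    rw [h1, e.left_inv h2]
  · filter_upwards [hge, e.open_target.mem_nhds (e.map_source ha)] with y h1 h2
    rw [h1, e.right_inv h2]

/-- Implicit function germ: `T (z, γ) = 0`, partial derivative in `γ` the identity. -/
lemma implgerm [FiniteDimensional ℝ E] [CompleteSpace F] (T : E × F → F) (hT : ContDiff ℝ ∞ T) (z₀ : E) (γ₀ : F)
    (h0 : T (z₀, γ₀) = 0) (A : E →L[ℝ] F)
    (hd : HasFDerivAt T (ContinuousLinearMap.snd ℝ E F - A.comp (ContinuousLinearMap.fst ℝ E F)) (z₀, γ₀)) :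
    ∃ g : E → F, ContDiff ℝ ∞ g ∧ g z₀ = γ₀ ∧ ∀ᶠ z in 𝓝 z₀, T (z, g z) = 0 := by
  have : CompleteSpace E := FiniteDimensional.complete ℝ E
  let L : (E × F) ≃L[ℝ] (E × F) := ContinuousLinearEquiv.equivOfInverse
    ((ContinuousLinearMap.fst ℝ E F).prod
      (ContinuousLinearMap.snd ℝ E F - A.comp (ContinuousLinearMap.fst ℝ E F)))
    ((ContinuousLinearMap.fst ℝ E F).prod
      (ContinuousLinearMap.snd ℝ E F + A.comp (ContinuousLinearMap.fst ℝ E F)))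
    (fun x => by ext <;> simp) (fun x => by ext <;> simp)
  have hL : HasFDerivAt (fun p : E × F => (p.1, T p)) (L : (E × F) →L[ℝ] (E × F)) (z₀, γ₀) :=
    (hasFDerivAt_fst).prodMk hd
  obtain ⟨e, he, ha, hs⟩ := invfun (fun p : E × F => (p.1, T p)) (contDiff_fst.prodMk hT) (z₀, γ₀) L hL
  have hez : e (z₀, γ₀) = (z₀, 0) := by rw [he]; simp [h0]
  have hmem : (z₀, (0 : F)) ∈ e.target := hez ▸ e.map_source ha
  have hι : ContDiff ℝ ∞ (fun z : E => (z, (0 : F))) := contDiff_id.prodMk contDiff_const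
  obtain ⟨g, hg, hge⟩ := cutoff (fun z : E => (e.symm (z, 0)).2) ((fun z : E => (z, (0 : F))) ⁻¹' e.target)
    (e.open_target.preimage hι.continuous) z₀ hmem
    (contDiff_snd.comp_contDiffOn (hs.comp hι.contDiffOn (fun _ h => h)))
  refine ⟨g, hg, ?_, ?_⟩
  · rw [hge.self_of_nhds, ← hez, e.left_inv ha]
  · filter_upwards [hge, (e.open_target.preimage hι.continuous).mem_nhds hmem] with z h1 h2
    have h3 := e.right_inv h2
    rw [he] at h3
    simp only [Prod.mk.injEq] at h3
    rw [h1]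
    have : ((z, (e.symm (z, 0)).2) : E × F) = e.symm (z, 0) := Prod.ext h3.1.symm rfl
    rw [this]; exact h3.2

end Cut


section Int
set_option linter.unusedSectionVars false
variable {E : Type} [NormedAddCommGroup E] [NormedSpace ℝ E]

/-- Extension of a curve on the unit interval to the line. -/
noncomputable def ext01 (γ : C(unitInterval, E)) (s : ℝ) : E := γ (Set.projIcc 0 1 zero_le_one s)

lemma ext01_cont (γ : C(unitInterval, E)) : Continuous (ext01 γ) :=
  γ.continuous.comp continuous_projIcc

lemma ext01_of_mem (γ : C(unitInterval, E)) (t : unitInterval) : ext01 γ t = γ t := by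
  simp [ext01]

/-- Integration from `0`. -/
noncomputable def intOp : C(unitInterval, E) →L[ℝ] C(unitInterval, E) :=
  LinearMap.mkContinuous
    { toFun := fun γ => ⟨fun t => ∫ r in (0:ℝ)..t, ext01 γ r,
        (intervalIntegral.continuous_primitive
          (fun a b => (ext01_cont γ).intervalIntegrable a b) 0).comp continuous_subtype_val⟩
      map_add' := fun γ η => by
        ext t
        exact intervalIntegral.integral_add ((ext01_cont γ).intervalIntegrable _ _)
          ((ext01_cont η).intervalIntegrable _ _)
      map_smul' := fun c γ => by
        ext t
        exact intervalIntegral.integral_smul c _ }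
    1 (fun γ => by
      rw [ContinuousMap.norm_le _ (by positivity)]
      intro t
      have h : ∀ x ∈ Set.uIoc (0:ℝ) t, ‖ext01 γ x‖ ≤ ‖γ‖ := fun x _ => γ.norm_coe_le_norm _
      have := intervalIntegral.norm_integral_le_of_norm_le_const h
      refine this.trans ?_
      rw [sub_zero, abs_of_nonneg t.2.1, mul_comm]
      exact mul_le_mul_of_nonneg_right t.2.2 (norm_nonneg γ))

lemma intOp_apply (γ : C(unitInterval, E)) (t : unitInterval) :
    intOp γ t = ∫ r in (0:ℝ)..t, ext01 γ r := rfl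

/-- Constant curves. -/
noncomputable def constOp : E →L[ℝ] C(unitInterval, E) :=
  LinearMap.mkContinuous
    { toFun := fun v => ContinuousMap.const _ v
      map_add' := fun _ _ => rfl
      map_smul' := fun _ _ => rfl }
    1 (fun v => by
      rw [ContinuousMap.norm_le _ (by positivity)]
      intro t
      exact le_of_eq (one_mul ‖v‖).symm)

@[simp] lemma constOp_apply (v : E) (t : unitInterval) : constOp v t = v := rfl

/-- Evaluation at `1`. -/
noncomputable def evOne : C(unitInterval, E) →L[ℝ] E := ContinuousMap.evalCLM ℝ 1

@[simp] lemma evOne_apply (γ : C(unitInterval, E)) : evOne γ = γ 1 := rfl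

/-- Relative Poincaré lemma along the range of a projector `Q`. -/
lemma poincare (β : E → E →L[ℝ] ℝ) (hβ : ContDiff ℝ ∞ β) (Q : E →L[ℝ] E)
    (hQ : ∀ v, Q (Q v) = Q v) (y₀ : E)
    (hc : ∀ᶠ y in 𝓝 y₀, ∀ v w, fderiv ℝ β y (Q v) (Q w) = fderiv ℝ β y (Q w) (Q v)) :
    ∃ b : E → ℝ, ContDiff ℝ ∞ b ∧ ∀ᶠ y in 𝓝 y₀, ∀ v, fderiv ℝ b y (Q v) = β y (Q v) := by
  let g : E × E → ℝ := fun p => β p.1 p.2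
  have hg : ContDiff ℝ ∞ g := (hβ.comp contDiff_fst).clm_apply contDiff_snd
  let Lc : E →L[ℝ] C(unitInterval, E × E) :=
    (ptApp ⟨fun t : unitInterval => (ContinuousLinearMap.id ℝ E - Q).prod Q
      + (t:ℝ) • Q.prod 0, by fun_prop⟩).comp constOp
  have hLc : ∀ v t, Lc v t = (v - Q v + (t:ℝ) • Q v, Q v) := fun v t => by
    simp [Lc]
  let c : E → C(unitInterval, E × E) := fun y => constOp (y₀, 0) + Lc (y - y₀)
  have hcs : ContDiff ℝ ∞ c := contDiff_const.add (Lc.contDiff.comp (contDiff_id.sub contDiff_const))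
  have hcd : ∀ y, HasFDerivAt c Lc y := fun y =>
    (Lc.hasFDerivAt.comp y ((hasFDerivAt_id y).sub_const y₀)).const_add _
  have hgc : Continuous (fderiv ℝ g) := hg.continuous_fderiv (by simp)
  let IL : C(unitInterval, ℝ) →L[ℝ] ℝ := evOne.comp intOp
  refine ⟨fun y => IL (nem ⟨g, hg.continuous⟩ (c y)),
    IL.contDiff.comp ((nem_contDiff g hg).comp hcs), ?_⟩
  obtain ⟨ε, hε, hb⟩ := Metric.eventually_nhds_iff_ball.1 hc
  have hc0 : c y₀ = constOp (y₀, 0) := by simp [c]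
  filter_upwards [hcs.continuous.continuousAt (Metric.ball_mem_nhds (c y₀) hε)] with y hy w
  have hd : HasFDerivAt (fun y => IL (nem ⟨g, hg.continuous⟩ (c y))) _ y :=
    IL.hasFDerivAt.comp y
      ((nem_hasFDerivAt g _ hg.continuous hgc
        (fun x => (hg.differentiable (by simp) x).hasFDerivAt) (c y)).comp y (hcd y))
  rw [hd.fderiv]
  simp only [ContinuousLinearMap.comp_apply, IL, evOne_apply, intOp_apply]
  set v := Q w with hv
  have hQv : Q v = v := hQ w
  set q := Q (y - y₀) with hq
  let x : ℝ → E := fun t => y₀ + (y - y₀ - q + t • q)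
  have hxd : ∀ t, HasDerivAt x q t := fun t => by
    have := (((hasDerivAt_id t).smul_const q).const_add (y - y₀ - q)).const_add y₀
    rw [one_smul] at this
    exact this
  have hcx : ∀ t : unitInterval, c y t = (x t, q) := fun t => by
    have : c y t = (y₀, 0) + Lc (y - y₀) t := rfl
    rw [this, hLc]
    simp [x, hq]
  have hball : ∀ t : unitInterval, x t ∈ Metric.ball y₀ ε := fun t => by
    have h1 : dist (c y t) (c y₀ t) < ε := lt_of_le_of_lt (ContinuousMap.dist_apply_le_dist t) hy
    rw [hcx, hc0, constOp_apply, Prod.dist_eq] at h1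
    exact lt_of_le_of_lt (le_max_left _ _) h1
  have hgd : ∀ p ξ : E × E, fderiv ℝ g p ξ = fderiv ℝ β p.1 ξ.1 p.2 + β p.1 ξ.2 := fun p ξ => by
    have h1 : HasFDerivAt (fun p : E × E => β p.1) _ p :=
      ((hβ.differentiable (by simp) p.1).hasFDerivAt).comp p hasFDerivAt_fst
    have h2 := h1.clm_apply (hasFDerivAt_snd (p := p))
    have h3 : HasFDerivAt g _ p := h2
    rw [h3.fderiv]
    simp [add_comm]
  have hderiv : ∀ t ∈ Set.uIcc (0:ℝ) ((1 : unitInterval) : ℝ), HasDerivAt (fun t => t * β (x t) v)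
      (ext01 (ptApp (nem ⟨fderiv ℝ g, hgc⟩ (c y)) (Lc v)) t) t := by
    intro t ht
    have ht' : t ∈ Set.Icc (0:ℝ) 1 := by simpa using ht
    have h1 : HasDerivAt (fun t => β (x t)) (fderiv ℝ β (x t) q) t :=
      ((hβ.differentiable (by simp) (x t)).hasFDerivAt).comp_hasDerivAt t (hxd t)
    have h2 : HasDerivAt (fun t => β (x t) v) (fderiv ℝ β (x t) q v) t := by
      simpa using h1.clm_apply (hasDerivAt_const t v)
    have h3 := (hasDerivAt_id t).mul h2
    convert! h3 using 1
    have h4 := ext01_of_mem (ptApp (nem ⟨fderiv ℝ g, hgc⟩ (c y)) (Lc v)) ⟨t, ht'⟩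
    simp only at h4
    rw [h4, ptApp_apply]
    have h5 : (nem ⟨fderiv ℝ g, hgc⟩ (c y)) ⟨t, ht'⟩ = fderiv ℝ g (x t, q) := by
      have := hcx ⟨t, ht'⟩
      simp only at this
      rw [← this]; rfl
    rw [h5, hgd, hLc, hQv]
    have h6 := hb _ (hball ⟨t, ht'⟩) w (y - y₀)
    simp only at h6
    rw [← hv, ← hq] at h6
    simp [h6]; ring
  rw [intervalIntegral.integral_eq_sub_of_hasDerivAt hderiv
    ((ext01_cont _).intervalIntegrable _ _)]
  simp [x]

end Int


section Flow
variable {E : Type} [NormedAddCommGroup E] [NormedSpace ℝ E] [FiniteDimensional ℝ E]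

lemma flow_gamma (K : E → E →L[ℝ] E) (hK : ContDiff ℝ ∞ K) (P : E →L[ℝ] E) (x₀ : E) :
    ∃ γ : E → C(unitInterval, E), ContDiff ℝ ∞ γ ∧ γ 0 = constOp x₀ ∧
      ∀ᶠ z in 𝓝 (0 : E), (∀ t : unitInterval,
          γ z t = x₀ + P z + ∫ r in (0:ℝ)..t, K (ext01 (γ z) r) z) ∧
        ∀ v, ∀ t : unitInterval, fderiv ℝ γ z v t = P v + ∫ r in (0:ℝ)..t,
          (fderiv ℝ K (ext01 (γ z) r) (ext01 (fderiv ℝ γ z v) r) z + K (ext01 (γ z) r) v) := by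
  have : CompleteSpace E := FiniteDimensional.complete ℝ E
  let C := C(unitInterval, E)
  let g : E × E → E := fun p => K p.2 p.1
  have hg : ContDiff ℝ ∞ g := (hK.comp contDiff_snd).clm_apply contDiff_fst
  have hgc : Continuous (fderiv ℝ g) := hg.continuous_fderiv (by simp)
  have hgd : ∀ p ξ : E × E, fderiv ℝ g p ξ = fderiv ℝ K p.2 ξ.2 p.1 + K p.2 ξ.1 := fun p ξ => by
    have h1 : HasFDerivAt (fun p : E × E => K p.2) _ p :=
      ((hK.differentiable (by simp) p.2).hasFDerivAt).comp p hasFDerivAt_snd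
    have h3 : HasFDerivAt g _ p := h1.clm_apply (hasFDerivAt_fst (p := p))
    rw [h3.fderiv]
    simp [add_comm]
  let ιl : C(unitInterval, E) →L[ℝ] C(unitInterval, E × E) :=
    ptApp (constOp (ContinuousLinearMap.inl ℝ E E))
  let ιr : C(unitInterval, E) →L[ℝ] C(unitInterval, E × E) :=
    ptApp (constOp (ContinuousLinearMap.inr ℝ E E))
  let pr : E × C(unitInterval, E) →L[ℝ] C(unitInterval, E × E) :=
    (ιl.comp constOp).coprod ιr
  have hpr : ∀ p t, pr p t = (p.1, p.2 t) := fun p t => by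
    simp [pr, ιl, ιr]
  let N : C(unitInterval, E × E) → C(unitInterval, E) := nem ⟨g, hg.continuous⟩
  have hNs : ContDiff ℝ ∞ N := nem_contDiff g hg
  have hNd : ∀ c, HasFDerivAt N (ptApp (nem ⟨fderiv ℝ g, hgc⟩ c)) c := fun c =>
    nem_hasFDerivAt g _ hg.continuous hgc (fun x => (hg.differentiable (by simp) x).hasFDerivAt) c
  let L : E × C(unitInterval, E) →L[ℝ] C(unitInterval, E) :=
    ContinuousLinearMap.snd ℝ _ _ - (constOp.comp P).comp (ContinuousLinearMap.fst ℝ _ _)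
  let T : E × C(unitInterval, E) → C(unitInterval, E) := fun p =>
    L p - constOp x₀ - intOp (N (pr p))
  have hT : ContDiff ℝ ∞ T :=
    (L.contDiff.sub contDiff_const).sub ((intOp (E := E)).contDiff.comp (hNs.comp pr.contDiff))
  have hTd : ∀ p, HasFDerivAt T
      (L - intOp.comp ((ptApp (nem ⟨fderiv ℝ g, hgc⟩ (pr p))).comp pr)) p := fun p =>
    (L.hasFDerivAt.sub_const _).sub
      ((intOp (E := E)).hasFDerivAt.comp p ((hNd (pr p)).comp p pr.hasFDerivAt))
  have hT0 : T (0, constOp x₀) = 0 := by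
    have h1 : N (pr (0, constOp x₀)) = 0 := by
      ext t
      change g (pr (0, constOp x₀) t) = 0
      rw [hpr]; simp [g]
    simp [T, h1, L]
  have hA : L - intOp.comp ((ptApp (nem ⟨fderiv ℝ g, hgc⟩ (pr (0, constOp x₀)))).comp pr)
      = ContinuousLinearMap.snd ℝ E C(unitInterval, E) -
        (constOp.comp P + intOp.comp (constOp.comp (K x₀))).comp
        (ContinuousLinearMap.fst ℝ E C(unitInterval, E)) := by
    refine ContinuousLinearMap.ext fun p => ?_
    have h1 : ptApp (nem ⟨fderiv ℝ g, hgc⟩ (pr (0, constOp x₀))) (pr p) = constOp (K x₀ p.1) := by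
      ext t
      change fderiv ℝ g (pr (0, constOp x₀) t) (pr p t) = K x₀ p.1
      rw [hgd, hpr, hpr]; simp
    simp only [L, sub_apply, ContinuousLinearMap.comp_apply,
      add_apply, h1, ContinuousLinearMap.coe_fst', ContinuousLinearMap.coe_snd']
    abel
  have hd0 := hTd (0, constOp x₀)
  rw [hA] at hd0
  obtain ⟨γ, hγ, hγ0, hγe⟩ := implgerm T hT 0 (constOp x₀) hT0 _ hd0
  refine ⟨γ, hγ, hγ0, ?_⟩
  filter_upwards [hγe, hγe.eventually_nhds] with z hz hz'
  constructor
  · intro t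
    have h1 : T (z, γ z) t = 0 := by rw [hz]; rfl
    have h2 : T (z, γ z) t = γ z t - P z - x₀ - ∫ r in (0:ℝ)..t, ext01 (N (pr (z, γ z))) r := rfl
    have h3 : ∀ r, ext01 (N (pr (z, γ z))) r = K (ext01 (γ z) r) z := by
      intro r
      change g (pr (z, γ z) _) = _
      rw [hpr]; rfl
    simp_rw [h3] at h2
    rw [h2] at h1
    have := sub_eq_zero.1 h1
    rw [← this]; abel
  · intro v t
    have hγd := (hγ.differentiable (by simp) z).hasFDerivAt
    have h0 : HasFDerivAt (fun z => T (z, γ z)) _ z :=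
      (hTd (z, γ z)).comp z ((hasFDerivAt_id z).prodMk hγd)
    have h00 : HasFDerivAt (fun z => T (z, γ z)) 0 z :=
      (hasFDerivAt_const (𝕜 := ℝ) (0 : C(unitInterval, E)) z).congr_of_eventuallyEq hz'
    have h01 := congrArg (fun A => A v t) (h0.unique h00)
    have h2 : ((L - intOp.comp ((ptApp (nem ⟨fderiv ℝ g, hgc⟩ (pr (z, γ z)))).comp pr)).comp
       ((ContinuousLinearMap.id ℝ E).prod (fderiv ℝ γ z))) v t = fderiv ℝ γ z v t - P v -
         ∫ r in (0:ℝ)..t, ext01 (ptApp (nem ⟨fderiv ℝ g, hgc⟩ (pr (z, γ z))) (pr (v, fderiv ℝ γ z v))) r := rfl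
    have h3 : ∀ r, ext01 (ptApp (nem ⟨fderiv ℝ g, hgc⟩ (pr (z, γ z))) (pr (v, fderiv ℝ γ z v))) r =
        (fderiv ℝ K (ext01 (γ z) r) (ext01 (fderiv ℝ γ z v) r) z + K (ext01 (γ z) r) v) := by
      intro r
      change fderiv ℝ g (pr (z, γ z) _) (pr (v, fderiv ℝ γ z v) _) = _
      rw [hpr, hpr, hgd]; rfl
    simp_rw [h3] at h2
    have := sub_eq_zero.1 (h2.symm.trans h01)
    rw [← this]; abel

/-- Darboux-type straightening by flowing along the kernel. -/
lemma flow_straight (B : E → E →L[ℝ] E →L[ℝ] ℝ) (hB : ContDiff ℝ ∞ B)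
    (K : E → E →L[ℝ] E) (hK : ContDiff ℝ ∞ K) (P : E →L[ℝ] E) (x₀ : E)
    (hsk : ∀ᶠ x in 𝓝 x₀, ∀ v w, B x v w = - B x w v)
    (hcl : ∀ᶠ x in 𝓝 x₀, ∀ u v w,
      fderiv ℝ B x u v w - fderiv ℝ B x v u w + fderiv ℝ B x w u v = 0)
    (hker : ∀ᶠ x in 𝓝 x₀, ∀ z, B x (K x z) = 0) :
    ∃ Φ : E → E, ContDiff ℝ ∞ Φ ∧ Φ 0 = x₀ ∧ (∀ v, fderiv ℝ Φ 0 v = P v + K x₀ v) ∧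
      ∀ᶠ z in 𝓝 (0 : E), ∀ v w,
        B (Φ z) (fderiv ℝ Φ z v) (fderiv ℝ Φ z w) = B (x₀ + P z) (P v) (P w) := by
  obtain ⟨γ, hγ, hγ0, hγe⟩ := flow_gamma K hK P x₀
  have hΦd : ∀ z v, fderiv ℝ (fun z => evOne (γ z)) z v = fderiv ℝ γ z v 1 := fun z v => by
    have h : HasFDerivAt (fun z => evOne (γ z)) _ z := (evOne (E := E)).hasFDerivAt.comp z
      (hγ.differentiable (by simp) z).hasFDerivAt
    rw [h.fderiv]; rfl
  refine ⟨fun z => evOne (γ z), (evOne (E := E)).contDiff.comp hγ, by simp [hγ0], ?_, ?_⟩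
  · intro v
    rw [hΦd, hγe.self_of_nhds.2 v 1]
    simp [hγ0, ext01]
  · have hall := (hsk.and (hcl.and (hker.and hker.eventually_nhds)))
    obtain ⟨ε, hε, hb⟩ := Metric.eventually_nhds_iff_ball.1 hall
    filter_upwards [hγe, hγ.continuous.continuousAt (Metric.ball_mem_nhds (γ 0) hε)] with z hz hzb v w
    have hball : ∀ s, ext01 (γ z) s ∈ Metric.ball x₀ ε := fun s => by
      have h1 := lt_of_le_of_lt (ContinuousMap.dist_apply_le_dist
        (f := γ z) (g := γ 0) (Set.projIcc 0 1 zero_le_one s)) hzb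
      rw [hγ0] at h1
      exact h1
    rw [hΦd, hΦd]
    have hKc : Continuous (fun r => K (ext01 (γ z) r)) := hK.continuous.comp (ext01_cont _)
    have hKc' : Continuous (fun r => fderiv ℝ K (ext01 (γ z) r)) :=
      (hK.continuous_fderiv (by simp)).comp (ext01_cont _)
    let a : ℝ → E := fun s => x₀ + P z + ∫ r in (0:ℝ)..s, K (ext01 (γ z) r) z
    let V : E → ℝ → E := fun v s => P v + ∫ r in (0:ℝ)..s,
          (fderiv ℝ K (ext01 (γ z) r) (ext01 (fderiv ℝ γ z v) r) z + K (ext01 (γ z) r) v)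
    have ha : ∀ s, HasDerivAt a (K (ext01 (γ z) s) z) s := fun s => by
      have hc : Continuous (fun r => K (ext01 (γ z) r) z) := hKc.clm_apply continuous_const
      exact (hc.integral_hasStrictDerivAt 0 s).hasDerivAt.const_add _
    have hV : ∀ v s, HasDerivAt (V v)
        (fderiv ℝ K (ext01 (γ z) s) (ext01 (fderiv ℝ γ z v) s) z + K (ext01 (γ z) s) v) s := fun v s => by
      have hc0 := ext01_cont (fderiv ℝ γ z v)
      have hc : Continuous (fun r => (fderiv ℝ K (ext01 (γ z) r) (ext01 (fderiv ℝ γ z v) r) z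
        + K (ext01 (γ z) r) v)) :=
        ((hKc'.clm_apply hc0).clm_apply continuous_const).add (hKc.clm_apply continuous_const)
      exact (hc.integral_hasStrictDerivAt 0 s).hasDerivAt.const_add _
    have hae : ∀ t : unitInterval, a t = ext01 (γ z) t := fun t => by
      rw [ext01_of_mem, hz.1 t]
    have hVe : ∀ v, ∀ t : unitInterval, V v t = ext01 (fderiv ℝ γ z v) t := fun v t => by
      rw [ext01_of_mem, hz.2 v t]
    let M : ℝ → ℝ := fun s => B (a s) (V v s) (V w s)
    have hM : ∀ s ∈ Set.Icc (0:ℝ) 1, HasDerivAt M 0 s := by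
      intro s hs
      have h1 : HasDerivAt (fun s => B (a s)) (fderiv ℝ B (a s) (K (ext01 (γ z) s) z)) s :=
        ((hB.differentiable (by simp) (a s)).hasFDerivAt).comp_hasDerivAt s (ha s)
      have h2 := (h1.clm_apply (hV v s)).clm_apply (hV w s)
      have hM0 : HasDerivAt M _ s := h2
      convert hM0 using 1
      have e1 := hae ⟨s, hs⟩
      have e2 := hVe v ⟨s, hs⟩
      have e3 := hVe w ⟨s, hs⟩
      simp only at e1 e2 e3
      rw [← e1, ← e2, ← e3]
      have hb' := hb _ (hball s)
      rw [← e1] at hb'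
      obtain ⟨b1, b2, b3, b4⟩ := hb'
      have key : ∀ X Y, fderiv ℝ B (a s) X (K (a s) z) Y + B (a s) (fderiv ℝ K (a s) X z) Y = 0 := by
        intro X Y
        have k1 : HasFDerivAt (fun x => K x z) _ (a s) :=
          ((hK.differentiable (by simp) (a s)).hasFDerivAt).clm_apply (hasFDerivAt_const z (a s))
        have k2 : HasFDerivAt (fun x => B x (K x z)) _ (a s) :=
          ((hB.differentiable (by simp) (a s)).hasFDerivAt).clm_apply k1
        have k3 : HasFDerivAt (fun x => B x (K x z)) 0 (a s) :=
          (hasFDerivAt_const (𝕜 := ℝ) (0 : E →L[ℝ] ℝ) (a s)).congr_of_eventuallyEq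
            (b4.mono fun x hx => hx z)
        have k4 := congrArg (fun A => A X Y) (k2.unique k3)
        simpa [add_comm] using k4
      have c1 := key (V v s) (V w s)
      have c2 := key (V w s) (V v s)
      have c3 := b2 (K (a s) z) (V v s) (V w s)
      have c4 := b1 (V v s) (fderiv ℝ K (a s) (V w s) z)
      have c5 := b1 (V v s) (K (a s) w)
      have c6 := b3 v
      have c7 := b3 w
      simp only [map_add, add_apply, c4, c5, c6, c7,
        zero_apply]
      linarith
    have hconst := constant_of_has_deriv_right_zero (a := 0) (b := 1) (f := M)
      (fun s hs => (hM s hs).continuousAt.continuousWithinAt)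
      (fun s hs => (hM s ⟨hs.1, hs.2.le⟩).hasDerivWithinAt) 1 ⟨zero_le_one, le_rfl⟩
    have e0 : M 0 = B (x₀ + P z) (P v) (P w) := by simp [M, a, V]
    have e1 : M 1 = B (evOne (γ z)) (fderiv ℝ γ z v 1) (fderiv ℝ γ z w 1) := by
      have f1 := hae 1
      have f2 := hVe v 1
      have f3 := hVe w 1
      rw [ext01_of_mem] at f1 f2 f3
      simp only [Set.Icc.coe_one] at f1 f2 f3
      simp only [M, f1, f2, f3, evOne_apply]
    rw [← e0, ← e1, hconst]

end Flow


section Pd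

lemma pd_congr {f g : Pt → ℝ} {x : Pt} (h : ∀ᶠ y in 𝓝 x, f y = g y) (i : Fin 4) : pd i f x = pd i g x := by
  unfold pd; rw [Filter.EventuallyEq.fderiv_eq h]

lemma sm_pd {f : Pt → ℝ} (hf : ContDiff ℝ ∞ f) (i : Fin 4) : ContDiff ℝ ∞ (pd i f) :=
  (hf.fderiv_right (m := ∞) (by simp)).clm_apply contDiff_const

lemma pd_mul {f g : Pt → ℝ} (hf : ContDiff ℝ ∞ f) (hg : ContDiff ℝ ∞ g) (i : Fin 4) (x : Pt) :
    pd i (fun y => f y * g y) x = pd i f x * g x + f x * pd i g x := by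
  unfold pd
  rw [fderiv_fun_mul (hf.differentiable (by simp) x) (hg.differentiable (by simp) x)]
  simp; ring

lemma pd_add {f g : Pt → ℝ} (hf : ContDiff ℝ ∞ f) (hg : ContDiff ℝ ∞ g) (i : Fin 4) (x : Pt) :
    pd i (fun y => f y + g y) x = pd i f x + pd i g x := by
  unfold pd
  rw [fderiv_fun_add (hf.differentiable (by simp) x) (hg.differentiable (by simp) x)]
  simp

lemma pd_sub {f g : Pt → ℝ} (hf : ContDiff ℝ ∞ f) (hg : ContDiff ℝ ∞ g) (i : Fin 4) (x : Pt) :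
    pd i (fun y => f y - g y) x = pd i f x - pd i g x := by
  unfold pd
  rw [fderiv_fun_sub (hf.differentiable (by simp) x) (hg.differentiable (by simp) x)]
  simp

lemma pd_neg (f : Pt → ℝ) (i : Fin 4) (x : Pt) :
    pd i (fun y => - f y) x = - pd i f x := by
  unfold pd
  rw [fderiv_fun_neg]
  simp

lemma pd_const (c : ℝ) (i : Fin 4) (x : Pt) : pd i (fun _ => c) x = 0 := by
  unfold pd; simp

lemma pd_coord (i j : Fin 4) (x : Pt) : pd i (fun y => y j) x = if j = i then 1 else 0 := by
  unfold pd
  have : HasFDerivAt (fun y : Pt => y j) (ContinuousLinearMap.proj (R := ℝ) (φ := fun _ : Fin 4 => ℝ) j) x :=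
    (ContinuousLinearMap.proj (R := ℝ) (φ := fun _ : Fin 4 => ℝ) j).hasFDerivAt
  rw [this.fderiv]
  simp [Pi.single_apply]

lemma pd_exp {f : Pt → ℝ} (hf : ContDiff ℝ ∞ f) (i : Fin 4) (x : Pt) :
    pd i (fun y => Real.exp (f y)) x = Real.exp (f x) * pd i f x := by
  unfold pd
  rw [fderiv_exp (hf.differentiable (by simp) x)]
  simp

lemma pd_comm {f : Pt → ℝ} (hf : ContDiff ℝ ∞ f) (i j : Fin 4) (x : Pt) :
    pd i (pd j f) x = pd j (pd i f) x := by
  have h := (hf.contDiffAt (x := x)).isSymmSndFDerivAt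
    (by simp only [minSmoothness_of_isRCLikeNormedField]; exact WithTop.coe_le_coe.2 (le_top : (2 : ℕ∞) ≤ ⊤))
  have hd : DifferentiableAt ℝ (fderiv ℝ f) x :=
    (hf.fderiv_right (m := ∞) (by simp)).differentiable (by simp) x
  have key : ∀ i j, pd i (pd j f) x = fderiv ℝ (fderiv ℝ f) x (Pi.single i 1) (Pi.single j 1) := by
    intro i j
    have : HasFDerivAt (pd j f) _ x :=
      hd.hasFDerivAt.clm_apply (hasFDerivAt_const (Pi.single j 1 : Pt) x)
    unfold pd at this ⊢
    rw [this.fderiv]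
    simp
  rw [key, key]
  exact h _ _

lemma fderiv_eq_sum (f : Pt → ℝ) (x v : Pt) : fderiv ℝ f x v = ∑ i, v i * pd i f x := by
  conv_lhs => rw [pi_eq_sum_univ' v]
  simp [pd, map_sum]

/-- Covector with given components. -/
noncomputable def covL : (Fin 4 → ℝ) →L[ℝ] (Pt →L[ℝ] ℝ) :=
  LinearMap.toContinuousLinearMap
    { toFun := fun c => ∑ i, c i • (ContinuousLinearMap.proj (R := ℝ) (φ := fun _ : Fin 4 => ℝ) i)
      map_add' := fun a b => by simp [add_smul, Finset.sum_add_distrib]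
      map_smul' := fun a b => by simp [Finset.smul_sum, smul_smul] }

lemma covL_apply (c : Fin 4 → ℝ) (v : Pt) : covL c v = ∑ i, c i * v i := by
  simp [covL]

lemma covL_single (c : Fin 4 → ℝ) (i : Fin 4) : covL c (Pi.single i 1) = c i := by
  simp [covL_apply, Pi.single_apply]

lemma poin (c : Fin 4 → Pt → ℝ) (hc : ∀ i, ContDiff ℝ ∞ (c i)) (S : Fin 4 → Bool)
    (h : ∀ᶠ y in 𝓝 (0 : Pt), ∀ i j, S i = true → S j = true → pd i (c j) y = pd j (c i) y) :
    ∃ b : Pt → ℝ, ContDiff ℝ ∞ b ∧ b 0 = 0 ∧ ∀ᶠ y in 𝓝 (0 : Pt), ∀ i, S i = true → pd i b y = c i y := by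
  let β : Pt → Pt →L[ℝ] ℝ := fun y => covL (fun i => c i y)
  have hcs : ContDiff ℝ ∞ (fun y i => c i y) := contDiff_pi.2 hc
  have hβ : ContDiff ℝ ∞ β := covL.contDiff.comp hcs
  let Q : Pt →L[ℝ] Pt := ContinuousLinearMap.pi fun i =>
    if S i = true then ContinuousLinearMap.proj (R := ℝ) (φ := fun _ : Fin 4 => ℝ) i else 0
  have hQ : ∀ v i, Q v i = if S i = true then v i else 0 := by
    intro v i
    simp only [Q, ContinuousLinearMap.coe_pi']
    split_ifs <;> simp
  have hβd : ∀ y u v, fderiv ℝ β y u v = ∑ i, ∑ j, u j * pd j (c i) y * v i := by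
    intro y u v
    have h1 : HasFDerivAt β _ y := covL.hasFDerivAt.comp y (hcs.differentiable (by simp) y).hasFDerivAt
    rw [h1.fderiv, ContinuousLinearMap.comp_apply, covL_apply]
    refine Finset.sum_congr rfl fun i _ => ?_
    have h2 : fderiv ℝ (fun y i => c i y) y u i = fderiv ℝ (c i) y u := by
      rw [fderiv_pi (fun i => (hc i).differentiable (by simp) y)]; rfl
    rw [h2, fderiv_eq_sum, Finset.sum_mul]
  obtain ⟨b, hb, hbe⟩ := poincare β hβ Q (fun v => by ext i; simp only [hQ]; split_ifs <;> rfl) 0 (by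
    filter_upwards [h] with y hy v w
    rw [hβd, hβd, Finset.sum_comm]
    refine Finset.sum_congr rfl fun i _ => Finset.sum_congr rfl fun j _ => ?_
    rw [hQ, hQ]
    by_cases hi : S i = true
    · by_cases hj : S j = true
      · rw [hy i j hi hj]; ring
      · simp [hj]
    · simp [hi])
  refine ⟨fun y => b y - b 0, hb.sub contDiff_const, by simp, ?_⟩
  filter_upwards [hbe] with y hy i hi
  have h1 := hy (Pi.single i 1)
  have h2 : Q (Pi.single i 1) = Pi.single i 1 := by
    ext j
    rw [hQ]
    by_cases hj : j = i
    · subst hj; simp [hi]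
    · simp [hj]
  rw [h2, covL_single] at h1
  rw [pd_sub hb contDiff_const, pd_const, sub_zero]
  exact h1

end Pd


section Core

lemma sm_coord (j : Fin 4) : ContDiff ℝ ∞ (fun y : Pt => y j) := contDiff_apply ℝ ℝ j

lemma core (O : Fin 4 → Fin 4 → Pt → ℝ) (hO : ∀ i j, ContDiff ℝ ∞ (O i j))
    (w : Fin 4 → Pt → ℝ) (hw : ∀ i, ContDiff ℝ ∞ (w i))
    (hsk : ∀ᶠ y in 𝓝 (0 : Pt), ∀ i j, O i j y = - O j i y)
    (hdw : ∀ᶠ y in 𝓝 (0 : Pt), ∀ i j, pd i (w j) y - pd j (w i) y = dxw 0 2 i j)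
    (hdO : ∀ᶠ y in 𝓝 (0 : Pt), ∀ i j k, pd i (O j k) y - pd j (O i k) y + pd k (O i j) y =
      w i y * O j k y - w j y * O i k y + w k y * O i j y) :
    ∃ f X2 X4 : Pt → ℝ, ContDiff ℝ ∞ f ∧ ContDiff ℝ ∞ X2 ∧ ContDiff ℝ ∞ X4 ∧
      f 0 = 0 ∧ X2 0 = 0 ∧ X4 0 = 0 ∧ ∀ᶠ y in 𝓝 (0 : Pt), ∀ i j, O i j y = Real.exp (f y) *
        (Real.exp ((1 + y 0) * y 2) *
            ((if i = 0 then 1 else 0) * pd j X2 y - (if j = 0 then 1 else 0) * pd i X2 y)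
          + ((if i = 2 then 1 else 0) * pd j X4 y - (if j = 2 then 1 else 0) * pd i X4 y)) := by
  have hp : ContDiff ℝ ∞ (fun y : Pt => 1 + y 0) := contDiff_const.add (sm_coord 0)
  have hpd : ∀ i x, pd i (fun y : Pt => 1 + y 0) x = if 0 = i then 1 else 0 := fun i x => by
    rw [pd_add contDiff_const (sm_coord 0), pd_const, pd_coord, zero_add]
  -- the function `f`
  obtain ⟨f, hf, hf0, hfe⟩ := poin (fun i y => w i y - (1 + y 0) * (if i = 2 then 1 else 0))
    (fun i => (hw i).sub (hp.mul contDiff_const)) (fun _ => true) (by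
      filter_upwards [hdw] with y hy i j _ _
      rw [pd_sub (hw j) (hp.mul contDiff_const), pd_sub (hw i) (hp.mul contDiff_const),
        pd_mul hp contDiff_const, pd_mul hp contDiff_const, hpd, hpd, pd_const, pd_const]
      have := hy i j
      simp only [dxw] at this
      rw [sub_eq_sub_iff_add_eq_add]
      rw [sub_eq_iff_eq_add] at this
      rw [this]
      fin_cases i <;> fin_cases j <;> simp <;> ring)
  -- the rescaled form `S`
  have hE : ContDiff ℝ ∞ (fun y => Real.exp (- f y)) := hf.neg.exp
  have hEd : ∀ i x, pd i (fun y => Real.exp (- f y)) x = - Real.exp (- f x) * pd i f x := fun i x => by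
    rw [pd_exp hf.neg, pd_neg]; ring
  let S : Fin 4 → Fin 4 → Pt → ℝ := fun i j y => Real.exp (- f y) * O i j y
  have hS : ∀ i j, ContDiff ℝ ∞ (S i j) := fun i j => hE.mul (hO i j)
  have hSsk : ∀ᶠ y in 𝓝 (0 : Pt), ∀ i j, S i j y = - S j i y := by
    filter_upwards [hsk] with y hy i j
    simp only [S]; rw [hy i j]; ring
  have hdS : ∀ᶠ y in 𝓝 (0 : Pt), ∀ i j k, pd i (S j k) y - pd j (S i k) y + pd k (S i j) y =
      (1 + y 0) * ((if i = 2 then 1 else 0) * S j k y - (if j = 2 then 1 else 0) * S i k y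
        + (if k = 2 then 1 else 0) * S i j y) := by
    filter_upwards [hdO, hfe] with y hy hy2 i j k
    simp only [S]
    rw [pd_mul hE (hO j k), pd_mul hE (hO i k), pd_mul hE (hO i j), hEd, hEd, hEd,
      hy2 i rfl, hy2 j rfl, hy2 k rfl]
    linear_combination Real.exp (- f y) * hy i j k
  -- components
  have d013 : ∀ᶠ y in 𝓝 (0 : Pt), pd 0 (S 1 3) y - pd 1 (S 0 3) y + pd 3 (S 0 1) y = 0 := by
    filter_upwards [hdS] with y hy
    have := hy 0 1 3
    simpa using this
  have d012 : ∀ᶠ y in 𝓝 (0 : Pt), pd 0 (S 1 2) y - pd 1 (S 0 2) y + pd 2 (S 0 1) y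
      = (1 + y 0) * S 0 1 y := by
    filter_upwards [hdS] with y hy
    have := hy 0 1 2
    simpa using this
  have d023 : ∀ᶠ y in 𝓝 (0 : Pt), pd 0 (S 2 3) y - pd 2 (S 0 3) y + pd 3 (S 0 2) y
      = (1 + y 0) * (- S 0 3 y) := by
    filter_upwards [hdS] with y hy
    have := hy 0 2 3
    simpa using this
  have d123 : ∀ᶠ y in 𝓝 (0 : Pt), pd 1 (S 2 3) y - pd 2 (S 1 3) y + pd 3 (S 1 2) y
      = (1 + y 0) * (- S 1 3 y) := by
    filter_upwards [hdS] with y hy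
    have := hy 1 2 3
    simpa using this
  have three : ∀ (l i j k : Fin 4) (p q r : Pt → ℝ), ContDiff ℝ ∞ p → ContDiff ℝ ∞ q → ContDiff ℝ ∞ r →
      ∀ x, pd l (fun y => pd i p y - pd j q y + pd k r y) x
        = pd l (pd i p) x - pd l (pd j q) x + pd l (pd k r) x := by
    intro l i j k p q r hp hq hr x
    rw [pd_add (f := fun y => pd i p y - pd j q y) (g := pd k r) ((sm_pd hp i).sub (sm_pd hq j)) (sm_pd hr k),
      pd_sub (f := pd i p) (g := pd j q) (sm_pd hp i) (sm_pd hq j)]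
  have h13 : ∀ᶠ y in 𝓝 (0 : Pt), S 1 3 y = 0 := by
    filter_upwards [d013, d013.eventually_nhds, d012.eventually_nhds, d023.eventually_nhds,
      d123.eventually_nhds] with y e0 e1 e2 e3 e4
    have a1 := pd_congr e1 2
    have a2 := pd_congr e2 3
    have a3 := pd_congr e3 1
    have a4 := pd_congr e4 0
    rw [three _ _ _ _ _ _ _ (hS _ _) (hS _ _) (hS _ _)] at a1 a2 a3 a4
    rw [pd_const] at a1
    rw [pd_mul hp (hS _ _), hpd] at a2
    rw [pd_mul hp (hS _ _).neg, hpd, pd_neg] at a3 a4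
    simp only [Fin.reduceEq, if_false, if_true, zero_ne_one] at a1 a2 a3 a4
    have c1 := pd_comm (hS 1 3) 2 0 y
    have c2 := pd_comm (hS 0 3) 2 1 y
    have c3 := pd_comm (hS 0 1) 2 3 y
    have c4 := pd_comm (hS 1 2) 3 0 y
    have c5 := pd_comm (hS 0 2) 3 1 y
    have c6 := pd_comm (hS 2 3) 1 0 y
    linear_combination (a4 - a3 + a1 - a2) - (1 + y 0) * e0 + c6 - c1 + c4 + c2 - c3 - c5
  -- the function `Y`
  obtain ⟨Y, hY, hY0, hYe⟩ := poin (fun i y => S 0 i y) (fun i => hS 0 i)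
    (fun i => i == 1 || i == 3) (by
      filter_upwards [d013, h13.eventually_nhds] with y e0 e1
      have a := pd_congr e1 0
      rw [pd_const] at a
      intro i j hi hj
      fin_cases i <;> fin_cases j <;> simp at hi hj ⊢ <;> linarith)
  have hY1 : ∀ᶠ y in 𝓝 (0 : Pt), pd 1 Y y = S 0 1 y := hYe.mono fun y h => h 1 rfl
  have hY3 : ∀ᶠ y in 𝓝 (0 : Pt), pd 3 Y y = S 0 3 y := hYe.mono fun y h => h 3 rfl
  have hx : ContDiff ℝ ∞ (fun y : Pt => (1 + y 0) * y 2) := hp.mul (sm_coord 2)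
  have hX : ContDiff ℝ ∞ (fun y : Pt => Real.exp (- ((1 + y 0) * y 2))) := hx.neg.exp
  have hXd : ∀ i x, pd i (fun y : Pt => Real.exp (- ((1 + y 0) * y 2))) x =
      - Real.exp (- ((1 + x 0) * x 2)) * ((if 0 = i then 1 else 0) * x 2
        + (1 + x 0) * (if 2 = i then 1 else 0)) := fun i x => by
    rw [pd_exp hx.neg, pd_neg, pd_mul hp (sm_coord 2), hpd, pd_coord]; ring
  -- the function `X4`
  let β : Fin 4 → Pt → ℝ := ![fun y => - S 0 2 y + pd 2 Y y - (1 + y 0) * Y y,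
    fun y => - S 1 2 y, 0, fun y => S 2 3 y]
  have hβ0 : ContDiff ℝ ∞ (β 0) := ((hS 0 2).neg.add (sm_pd hY 2)).sub (hp.mul hY)
  have hβ0d : ∀ i x, pd i (β 0) x = - pd i (S 0 2) x + pd i (pd 2 Y) x
      - ((if 0 = i then 1 else 0) * Y x + (1 + x 0) * pd i Y x) := fun i x => by
    have : β 0 = fun y => - S 0 2 y + pd 2 Y y - (1 + y 0) * Y y := rfl
    rw [this, pd_sub ((hS 0 2).neg.add (sm_pd hY 2)) (hp.mul hY), pd_mul hp hY, hpd,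
      pd_add (hS 0 2).neg (sm_pd hY 2), pd_neg]
  have hβ1d : ∀ i x, pd i (β 1) x = - pd i (S 1 2) x := fun i x => pd_neg _ _ _
  have hβ3 : β 3 = S 2 3 := rfl
  obtain ⟨X4, hX4, hX40, hX4e⟩ := poin β (fun i => by
      fin_cases i
      · exact hβ0
      · exact (hS 1 2).neg
      · exact contDiff_const
      · exact hS 2 3)
    (fun i => i != 2) (by
      filter_upwards [d012, d023, d123, h13, h13.eventually_nhds, hY1.eventually_nhds,
        hY3.eventually_nhds] with y e012 e023 e123 e13 n13 n1 n3
      have a13 := pd_congr n13 2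
      rw [pd_const] at a13
      have b1 := pd_congr n1 2
      have b3 := pd_congr n3 2
      have c1 := pd_comm hY 2 1 y
      have c3 := pd_comm hY 2 3 y
      have f1 := n1.self_of_nhds
      have f3 := n3.self_of_nhds
      have r01 : pd 0 (β 1) y = pd 1 (β 0) y := by
        rw [hβ0d, hβ1d]; simp only [Fin.reduceEq, if_false, zero_ne_one]
        rw [f1]; linarith
      have r03 : pd 0 (β 3) y = pd 3 (β 0) y := by
        rw [hβ0d, hβ3]; simp only [Fin.reduceEq, if_false]
        rw [f3]; linarith
      have r13 : pd 1 (β 3) y = pd 3 (β 1) y := by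
        rw [hβ1d, hβ3]; rw [e13] at e123; linarith
      intro i j hi hj
      fin_cases i <;> fin_cases j <;> simp at hi hj ⊢ <;> first | exact r01 | exact r03 | exact r13 | exact r01.symm | exact r03.symm | exact r13.symm)
  refine ⟨f, fun y => Real.exp (- ((1 + y 0) * y 2)) * Y y, X4, hf, hX.mul hY, hX4, hf0,
    by simp [hY0], hX40, ?_⟩
  filter_upwards [hSsk, h13, hY1, hY3, hX4e] with y hs e13 f1 f3 hx4
  have g0 := hx4 0 rfl
  have g1 := hx4 1 rfl
  have g3 := hx4 3 rfl
  have hX2d : ∀ i, Real.exp ((1 + y 0) * y 2) * pd i (fun y => Real.exp (- ((1 + y 0) * y 2)) * Y y) y =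
      pd i Y y - ((if 0 = i then 1 else 0) * y 2 + (1 + y 0) * (if 2 = i then 1 else 0)) * Y y := by
    intro i
    rw [pd_mul hX hY, hXd]
    have : Real.exp ((1 + y 0) * y 2) * Real.exp (- ((1 + y 0) * y 2)) = 1 := by
      rw [← Real.exp_add]; simp
    linear_combination (pd i Y y - ((if 0 = i then 1 else 0) * y 2
      + (1 + y 0) * (if 2 = i then 1 else 0)) * Y y) * this
  have hOS : ∀ i j, O i j y = Real.exp (f y) * S i j y := fun i j => by
    simp only [S]
    rw [← mul_assoc, ← Real.exp_add]; simp
  intro i j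
  rw [hOS]
  congr 1
  set X2 := fun y : Pt => Real.exp (- ((1 + y 0) * y 2)) * Y y
  have expand : ∀ i j : Fin 4, Real.exp ((1 + y 0) * y 2) *
            ((if i = 0 then 1 else 0) * pd j X2 y - (if j = 0 then 1 else 0) * pd i X2 y) =
        (if i = 0 then 1 else 0) * (pd j Y y - ((if 0 = j then 1 else 0) * y 2 + (1 + y 0) * (if 2 = j then 1 else 0)) * Y y)
        - (if j = 0 then 1 else 0) * (pd i Y y - ((if 0 = i then 1 else 0) * y 2 + (1 + y 0) * (if 2 = i then 1 else 0)) * Y y) := by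
    intro i j
    rw [← hX2d, ← hX2d]; ring
  rw [expand]
  have k0 : β 0 y = - S 0 2 y + pd 2 Y y - (1 + y 0) * Y y := rfl
  have k1 : β 1 y = - S 1 2 y := rfl
  have k3 : β 3 y = S 2 3 y := rfl
  rw [k0] at g0
  rw [k1] at g1
  rw [k3] at g3
  have s00 := hs 0 0
  have s11 := hs 1 1
  have s22 := hs 2 2
  have s33 := hs 3 3
  have s01 := hs 1 0
  have s02 := hs 2 0
  have s03 := hs 3 0
  have s12 := hs 2 1
  have s13 := hs 3 1
  have s23 := hs 3 2
  fin_cases i <;> fin_cases j <;> simp <;> linarith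

end Core


section LinAlg

/-- Bilinear form with given components. -/
noncomputable def bilL : (Fin 4 → Fin 4 → ℝ) →L[ℝ] (Pt →L[ℝ] Pt →L[ℝ] ℝ) :=
  LinearMap.toContinuousLinearMap
    { toFun := fun b => ∑ i, (ContinuousLinearMap.proj (R := ℝ) (φ := fun _ : Fin 4 => ℝ) i).smulRight (covL (b i))
      map_add' := fun a b => by
        rw [← Finset.sum_add_distrib]
        refine Finset.sum_congr rfl fun i _ => ?_
        ext v w
        simp
      map_smul' := fun a b => by
        rw [Finset.smul_sum]
        refine Finset.sum_congr rfl fun i _ => ?_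
        ext v w
        simp; ring }

lemma bilL_apply (b : Fin 4 → Fin 4 → ℝ) (v w : Pt) : bilL b v w = ∑ i, ∑ j, b i j * v i * w j := by
  simp only [bilL, LinearMap.coe_toContinuousLinearMap', LinearMap.coe_mk, AddHom.coe_mk,
    sum_apply, ContinuousLinearMap.smulRight_apply, ContinuousLinearMap.proj_apply,
    smul_apply, covL_apply, smul_eq_mul, Finset.mul_sum]
  refine Finset.sum_congr rfl fun i _ => Finset.sum_congr rfl fun j _ => ?_
  ring

lemma bilL_single (b : Fin 4 → Fin 4 → ℝ) (i j : Fin 4) :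
    bilL b (Pi.single i 1) (Pi.single j 1) = b i j := by
  simp [bilL_apply, Pi.single_apply]

lemma bilL_skew {b : Fin 4 → Fin 4 → ℝ} (hb : ∀ i j, b i j = - b j i) (v w : Pt) :
    bilL b v w = - bilL b w v := by
  rw [bilL_apply, bilL_apply, Finset.sum_comm, ← Finset.sum_neg_distrib]
  refine Finset.sum_congr rfl fun i _ => ?_
  rw [← Finset.sum_neg_distrib]
  refine Finset.sum_congr rfl fun j _ => ?_
  rw [hb j i]; ring

/-- Dual components. -/
def bst (b : Fin 4 → Fin 4 → ℝ) : Fin 4 → Fin 4 → ℝ :=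
  ![![0, b 2 3, - b 1 3, b 1 2], ![- b 2 3, 0, b 0 3, - b 0 2],
    ![b 1 3, - b 0 3, 0, b 0 1], ![- b 1 2, b 0 2, - b 0 1, 0]]

/-- The Pfaffian. -/
def pf (b : Fin 4 → Fin 4 → ℝ) : ℝ := b 0 1 * b 2 3 - b 0 2 * b 1 3 + b 0 3 * b 1 2

lemma bst_ker {b : Fin 4 → Fin 4 → ℝ} (hb : ∀ i j, b i j = - b j i) (h : pf b = 0) (k : Fin 4) :
    bilL b (fun i => bst b i k) = 0 := by
  ext1 w
  rw [bilL_apply]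
  have s00 := hb 0 0
  have s11 := hb 1 1
  have s22 := hb 2 2
  have s33 := hb 3 3
  have r00 : b 0 0 = 0 := by linarith
  have r11 : b 1 1 = 0 := by linarith
  have r22 : b 2 2 = 0 := by linarith
  have r33 : b 3 3 = 0 := by linarith
  have s01 := hb 1 0
  have s02 := hb 2 0
  have s03 := hb 3 0
  have s12 := hb 2 1
  have s13 := hb 3 1
  have s23 := hb 3 2
  simp only [Fin.sum_univ_four, r00, r11, r22, r33, s01, s02, s03, s12, s13, s23]
  unfold pf at h
  fin_cases k <;> simp [bst]
  · linear_combination (w 0) * h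
  · linear_combination (w 1) * h
  · linear_combination (w 2) * h
  · linear_combination (w 3) * h

lemma pf_nondeg {b : Fin 4 → Fin 4 → ℝ} (hb : ∀ i j, b i j = - b j i) (h : pf b ≠ 0) (v : Pt)
    (hv : ∀ j, ∑ i, b i j * v i = 0) : v = 0 := by
  have s00 := hb 0 0
  have s11 := hb 1 1
  have s22 := hb 2 2
  have s33 := hb 3 3
  have r00 : b 0 0 = 0 := by linarith
  have r11 : b 1 1 = 0 := by linarith
  have r22 : b 2 2 = 0 := by linarith
  have r33 : b 3 3 = 0 := by linarith
  have s01 := hb 1 0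
  have s02 := hb 2 0
  have s03 := hb 3 0
  have s12 := hb 2 1
  have s13 := hb 3 1
  have s23 := hb 3 2
  simp only [Fin.sum_univ_four] at hv
  have h0 := hv 0
  have h1 := hv 1
  have h2 := hv 2
  have h3 := hv 3
  simp only [r00, r11, r22, r33, s01, s02, s03, s12, s13, s23] at h0 h1 h2 h3
  have key : ∀ k, pf b * v k = 0 := by
    intro k
    unfold pf
    fin_cases k <;> simp only [Fin.zero_eta, Fin.mk_one, Fin.reduceFinMk]
    · linear_combination b 2 3 * h1 - b 1 3 * h2 + b 1 2 * h3
    · linear_combination - b 2 3 * h0 + b 0 3 * h2 - b 0 2 * h3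
    · linear_combination b 1 3 * h0 - b 0 3 * h1 + b 0 1 * h3
    · linear_combination - b 1 2 * h0 + b 0 2 * h1 - b 0 1 * h2
  ext k
  exact (mul_eq_zero.1 (key k)).resolve_left h

lemma linalg_choice {b : Fin 4 → Fin 4 → ℝ} (hb : ∀ i j, b i j = - b j i) (h : b ≠ 0) :
    ∃ (p q : Pt) (k l : Fin 4), bilL b p q = 1 ∧
      ∀ s t : ℝ, (∀ i, s * bst b i k + t * bst b i l = 0) → s = 0 ∧ t = 0 := by
  have key : ∀ i j k l : Fin 4, b i j ≠ 0 → bst b k k = 0 → bst b l l = 0 →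
      (bst b l k = b i j ∨ bst b l k = - b i j) → (bst b k l = b i j ∨ bst b k l = - b i j) →
      ∃ (p q : Pt) (k l : Fin 4), bilL b p q = 1 ∧
      ∀ s t : ℝ, (∀ i, s * bst b i k + t * bst b i l = 0) → s = 0 ∧ t = 0 := by
    intro i j k l hij hk hl hlk hkl
    refine ⟨Pi.single i 1, (b i j)⁻¹ • Pi.single j 1, k, l, ?_, ?_⟩
    · rw [map_smul, bilL_single, smul_eq_mul, inv_mul_cancel₀ hij]
    · intro s t hst
      have h1 := hst k
      have h2 := hst l
      rw [hk] at h1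
      rw [hl] at h2
      have n1 : bst b l k ≠ 0 := by rcases hlk with e | e <;> rw [e] <;> simpa using hij
      have n2 : bst b k l ≠ 0 := by rcases hkl with e | e <;> rw [e] <;> simpa using hij
      simp [n1, n2] at h1 h2
      exact ⟨h2, h1⟩
  by_cases h01 : b 0 1 = 0
  · by_cases h02 : b 0 2 = 0
    · by_cases h03 : b 0 3 = 0
      · by_cases h12 : b 1 2 = 0
        · by_cases h13 : b 1 3 = 0
          · by_cases h23 : b 2 3 = 0
            · refine absurd ?_ h
              have s00 := hb 0 0
              have s11 := hb 1 1
              have s22 := hb 2 2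
              have s33 := hb 3 3
              have s01 := hb 1 0
              have s02 := hb 2 0
              have s03 := hb 3 0
              have s12 := hb 2 1
              have s13 := hb 3 1
              have s23 := hb 3 2
              ext i j
              fin_cases i <;> fin_cases j <;> simp <;> linarith
            · exact key 2 3 0 1 h23 rfl rfl (by simp [bst]) (by simp [bst])
          · exact key 1 3 0 2 h13 rfl rfl (by simp [bst]) (by simp [bst])
        · exact key 1 2 0 3 h12 rfl rfl (by simp [bst]) (by simp [bst])
      · exact key 0 3 1 2 h03 rfl rfl (by simp [bst]) (by simp [bst])
    · exact key 0 2 1 3 h02 rfl rfl (by simp [bst]) (by simp [bst])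
  · exact key 0 1 2 3 h01 rfl rfl (by simp [bst]) (by simp [bst])

lemma covec_apply (c : Fin 4 → ℝ) (v : Pt) : covec c v = ∑ i, c i * v i := by
  simp [covec]

lemma d1_skew (o : Form1) (x : Pt) (i j : Fin 4) : d1 o x i j = - d1 o x j i := by
  simp [d1]

lemma class_pf {o : Form1} {x : Pt} (h : classAt o x = 3) : pf (d1 o x) = 0 := by
  by_contra hne
  unfold classAt at h
  have h1 : LinearMap.ker (covec (o x)) ⊓ ⨅ j, LinearMap.ker (covec (fun i => d1 o x i j)) = ⊥ := by
    rw [eq_bot_iff]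
    intro v hv
    rw [Submodule.mem_inf, Submodule.mem_iInf] at hv
    rw [Submodule.mem_bot]
    refine pf_nondeg (d1_skew o x) hne v fun j => ?_
    have := hv.2 j
    rwa [LinearMap.mem_ker, covec_apply] at this
  rw [h1] at h
  simp at h

lemma class_ne {o : Form1} {x : Pt} (h : classAt o x = 3) : d1 o x ≠ 0 := by
  intro h0
  unfold classAt at h
  have h1 : LinearMap.ker (covec (o x)) ⊓ ⨅ j, LinearMap.ker (covec (fun i => d1 o x i j)) =
      LinearMap.ker (covec (o x)) := by
    rw [inf_eq_left]
    intro v _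
    rw [Submodule.mem_iInf]
    intro j
    rw [LinearMap.mem_ker, covec_apply]
    simp [h0]
  rw [h1] at h
  have h2 := LinearMap.finrank_range_add_finrank_ker (covec (o x))
  have h3 := Submodule.finrank_le (LinearMap.range (covec (o x)))
  simp at h2 h3
  omega

/-- Trilinear extension of alternating identities. -/
lemma alt3_sum (T : Pt →L[ℝ] Pt →L[ℝ] Pt →L[ℝ] ℝ) (u v w : Pt) :
    T u v w - T v u w + T w u v = ∑ i, ∑ j, ∑ k, u i * v j * w k *
      (T (Pi.single i 1) (Pi.single j 1) (Pi.single k 1)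
      - T (Pi.single j 1) (Pi.single i 1) (Pi.single k 1)
      + T (Pi.single k 1) (Pi.single i 1) (Pi.single j 1)) := by
  have ex : ∀ u v w : Pt, T u v w = ∑ i, ∑ j, ∑ k, u i * v j * w k *
      T (Pi.single i 1) (Pi.single j 1) (Pi.single k 1) := by
    intro u v w
    conv_lhs => rw [pi_eq_sum_univ' u, pi_eq_sum_univ' v, pi_eq_sum_univ' w]
    simp only [map_sum, map_smul, sum_apply, smul_apply,
      smul_eq_mul, Finset.mul_sum]
    rw [Finset.sum_comm]
    refine ((Finset.sum_congr rfl fun j _ => Finset.sum_comm).trans Finset.sum_comm).trans ?_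
    refine Finset.sum_congr rfl fun i _ => Finset.sum_congr rfl fun j _ => Finset.sum_congr rfl fun k _ => ?_
    ring
  have e1 := ex u v w
  have e2 : T v u w = ∑ i, ∑ j, ∑ k, u i * v j * w k *
      T (Pi.single j 1) (Pi.single i 1) (Pi.single k 1) := by
    rw [ex, Finset.sum_comm]
    refine Finset.sum_congr rfl fun i _ => Finset.sum_congr rfl fun j _ => Finset.sum_congr rfl fun k _ => ?_
    ring
  have e3 : T w u v = ∑ i, ∑ j, ∑ k, u i * v j * w k *
      T (Pi.single k 1) (Pi.single i 1) (Pi.single j 1) := by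
    rw [ex, Finset.sum_comm]
    refine Finset.sum_congr rfl fun i _ => ?_
    rw [Finset.sum_comm]
    refine Finset.sum_congr rfl fun j _ => Finset.sum_congr rfl fun k _ => ?_
    ring
  rw [e1, e2, e3]
  simp only [← Finset.sum_sub_distrib, ← Finset.sum_add_distrib]
  refine Finset.sum_congr rfl fun i _ => Finset.sum_congr rfl fun j _ => Finset.sum_congr rfl fun k _ => ?_
  ring

lemma alt3 (T : Pt →L[ℝ] Pt →L[ℝ] Pt →L[ℝ] ℝ)
    (h : ∀ i j k : Fin 4, T (Pi.single i 1) (Pi.single j 1) (Pi.single k 1)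
      - T (Pi.single j 1) (Pi.single i 1) (Pi.single k 1)
      + T (Pi.single k 1) (Pi.single i 1) (Pi.single j 1) = 0) (u v w : Pt) :
    T u v w - T v u w + T w u v = 0 := by
  rw [alt3_sum]
  simp [h]

lemma alt3b (T T' : Pt →L[ℝ] Pt →L[ℝ] Pt →L[ℝ] ℝ)
    (h : ∀ i j k : Fin 4, T (Pi.single i 1) (Pi.single j 1) (Pi.single k 1)
      - T (Pi.single j 1) (Pi.single i 1) (Pi.single k 1)
      + T (Pi.single k 1) (Pi.single i 1) (Pi.single j 1) =
      T' (Pi.single i 1) (Pi.single j 1) (Pi.single k 1)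
      - T' (Pi.single j 1) (Pi.single i 1) (Pi.single k 1)
      + T' (Pi.single k 1) (Pi.single i 1) (Pi.single j 1)) (u v w : Pt) :
    T u v w - T v u w + T w u v = T' u v w - T' v u w + T' w u v := by
  rw [alt3_sum, alt3_sum]
  simp only [h]

/-- An injective endomorphism of `ℝ⁴` is an equivalence. -/
lemma equiv_of_inj (A : Pt →L[ℝ] Pt) (h : ∀ v, A v = 0 → v = 0) :
    ∃ e : Pt ≃L[ℝ] Pt, (e : Pt →L[ℝ] Pt) = A := by
  have hi : Function.Injective (A : Pt →ₗ[ℝ] Pt) := (injective_iff_map_eq_zero _).2 h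
  refine ⟨(LinearEquiv.ofInjectiveEndo (A : Pt →ₗ[ℝ] Pt) hi).toContinuousLinearEquiv, ?_⟩
  ext v : 1
  rfl

end LinAlg


section Straight

lemma bil_smooth {b : Form2} (hb : ContDiff ℝ ∞ b) : ContDiff ℝ ∞ (fun x => bilL (b x)) := by
  have h : ContDiff ℝ ∞ (fun x => ∑ i, (ContinuousLinearMap.proj (R := ℝ) (φ := fun _ : Fin 4 => ℝ) i).smulRight
      (covL (b x i))) :=
    ContDiff.sum fun i _ => contDiff_const.smulRight (covL.contDiff.comp (contDiff_pi.1 hb i))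
  exact h

lemma bil_fderiv {b : Form2} (hb : ContDiff ℝ ∞ b) (x : Pt) (i j k : Fin 4) :
    fderiv ℝ (fun x => bilL (b x)) x (Pi.single i 1) (Pi.single j 1) (Pi.single k 1) =
      pd i (fun y => b y j k) x := by
  have h1 : ContDiff ℝ ∞ (fun x => bilL (b x)) := bil_smooth hb
  have h2 := (h1.differentiable (by simp) x).hasFDerivAt
  have h3 := (h2.clm_apply (hasFDerivAt_const (Pi.single j 1 : Pt) x)).clm_apply
    (hasFDerivAt_const (Pi.single k 1 : Pt) x)
  simp only [bilL_single] at h3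
  unfold pd
  rw [h3.fderiv]
  simp

lemma smooth_comp2 {b : Form2} (hb : ContDiff ℝ ∞ b) (i j : Fin 4) : ContDiff ℝ ∞ (fun x => b x i j) :=
  contDiff_pi.1 (contDiff_pi.1 hb i) j

lemma straight (b : Form2) (hb : ContDiff ℝ ∞ b) (x₀ : Pt)
    (hsk : ∀ᶠ x in 𝓝 x₀, ∀ i j, b x i j = - b x j i)
    (hpf : ∀ᶠ x in 𝓝 x₀, pf (b x) = 0)
    (hcl : ∀ᶠ x in 𝓝 x₀, ∀ i j k, d2 b x i j k = 0)
    (hne : b x₀ ≠ 0) :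
    ∃ Φ : Pt → Pt, ContDiff ℝ ∞ Φ ∧ Φ 0 = x₀ ∧ (∀ v, fderiv ℝ Φ 0 v = 0 → v = 0) ∧
      ∀ᶠ z in 𝓝 (0 : Pt), ∀ v w, bilL (b (Φ z)) (fderiv ℝ Φ z v) (fderiv ℝ Φ z w) =
        v 0 * w 2 - v 2 * w 0 := by
  obtain ⟨p, q, k, l, hpq, hkl⟩ := linalg_choice hsk.self_of_nhds hne
  have hB : ContDiff ℝ ∞ (fun x => bilL (b x)) := bil_smooth hb
  let pr : Fin 4 → Pt →L[ℝ] ℝ := fun i => ContinuousLinearMap.proj (R := ℝ) (φ := fun _ : Fin 4 => ℝ) i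
  let P : Pt →L[ℝ] Pt := (pr 0).smulRight p + (pr 2).smulRight q
  have hP : ∀ v, P v = v 0 • p + v 2 • q := fun v => rfl
  let col : Fin 4 → Pt → Pt := fun k x i => bst (b x) i k
  have hcol : ∀ k, ContDiff ℝ ∞ (col k) := by
    intro k
    refine contDiff_pi.2 fun i => ?_
    have c := fun i j => smooth_comp2 hb i j
    have c' := fun i j => (smooth_comp2 hb i j).neg
    fin_cases k <;> fin_cases i <;> simp [col, bst] <;>
      first | exact contDiff_const | exact c _ _ | exact c' _ _
  let K : Pt → Pt →L[ℝ] Pt := fun x => (pr 1).smulRight (col k x) + (pr 3).smulRight (col l x)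
  have hKa : ∀ x v, K x v = v 1 • col k x + v 3 • col l x := fun x v => rfl
  have hK : ContDiff ℝ ∞ K :=
    (contDiff_const.smulRight (hcol k)).add (contDiff_const.smulRight (hcol l))
  have hsk' : ∀ᶠ x in 𝓝 x₀, ∀ v w, bilL (b x) v w = - bilL (b x) w v :=
    hsk.mono fun x hx => bilL_skew hx
  have hker : ∀ᶠ x in 𝓝 x₀, ∀ z, bilL (b x) (K x z) = 0 := by
    filter_upwards [hsk, hpf] with x h1 h2 z
    rw [hKa, map_add, map_smul, map_smul, bst_ker h1 h2, bst_ker h1 h2]; simp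
  obtain ⟨Φ, hΦ, hΦ0, hΦd, hΦe⟩ := flow_straight (fun x => bilL (b x)) hB K hK P x₀ hsk' (by
    filter_upwards [hcl] with x hx
    refine alt3 _ fun i j k => ?_
    rw [bil_fderiv hb, bil_fderiv hb, bil_fderiv hb]
    exact hx i j k) hker
  have hinj : ∀ v, fderiv ℝ Φ 0 v = 0 → v = 0 := by
    intro v hv
    rw [hΦd] at hv
    have s := hsk'.self_of_nhds
    have kr := hker.self_of_nhds
    have pp : bilL (b x₀) p p = 0 := by have := s p p; linarith
    have qq : bilL (b x₀) q q = 0 := by have := s q q; linarith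
    have a1 : bilL (b x₀) (P v + K x₀ v) q = 0 := by rw [hv]; simp
    have a2 : bilL (b x₀) (P v + K x₀ v) p = 0 := by rw [hv]; simp
    rw [map_add, kr, add_zero, hP, map_add, map_smul, map_smul] at a1 a2
    simp only [add_apply, smul_apply, smul_eq_mul] at a1 a2
    rw [s q p] at a2
    rw [hpq, qq] at a1
    rw [hpq, pp] at a2
    have v0 : v 0 = 0 := by linarith
    have v2 : v 2 = 0 := by linarith
    rw [hP, v0, v2, hKa] at hv
    have h13 := hkl (v 1) (v 3) (fun i => by
      have := congrFun hv i
      simpa [col] using this)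
    ext i
    fin_cases i
    · exact v0
    · exact h13.1
    · exact v2
    · exact h13.2
  -- the function h
  let h : Pt → ℝ := fun z => bilL (b (x₀ + P z)) p q
  have hh : ContDiff ℝ ∞ h :=
    ((hB.comp (contDiff_const.add P.contDiff)).clm_apply contDiff_const).clm_apply contDiff_const
  have hh0 : h 0 = 1 := by simp [h, hpq]
  have hhi : ∀ i, P (Pi.single i 1) = 0 → ∀ z, pd i h z = 0 := by
    intro i hi z
    let H : Pt → ℝ := fun y => bilL (b (x₀ + y)) p q
    have hH : ContDiff ℝ ∞ H :=
      ((hB.comp (contDiff_const.add contDiff_id)).clm_apply contDiff_const).clm_apply contDiff_const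
    have h1 : HasFDerivAt h _ z := (hH.differentiable (by simp) (P z)).hasFDerivAt.comp z P.hasFDerivAt
    unfold pd
    rw [h1.fderiv, ContinuousLinearMap.comp_apply, hi, map_zero]
  have hP1 : P (Pi.single 1 1) = 0 := by rw [hP]; simp
  have hP3 : P (Pi.single 3 1) = 0 := by rw [hP]; simp
  obtain ⟨G, hG, hG0, hGe⟩ := poin ![h, fun _ => 0, fun _ => 0, fun _ => 0] (fun i => by
      fin_cases i
      · exact hh
      · exact contDiff_const
      · exact contDiff_const
      · exact contDiff_const) (fun i => i != 2) (by
      refine Eventually.of_forall fun y => ?_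
      have e1 := hhi 1 hP1 y
      have e3 := hhi 3 hP3 y
      intro i j hi hj
      fin_cases i <;> fin_cases j <;> simp [pd_const, e1, e3] at hi hj ⊢)
  have hGd : ∀ᶠ z in 𝓝 (0 : Pt), ∀ v, fderiv ℝ G z v = v 0 * h z + v 2 * pd 2 G z := by
    filter_upwards [hGe] with z hz v
    have g0 := hz 0 rfl
    have g1 := hz 1 rfl
    have g3 := hz 3 rfl
    rw [fderiv_eq_sum, Fin.sum_univ_four, g0, g1, g3]
    simp
  let ξ : Pt → Pt := fun z i => if i = 0 then G z else z i
  have hξ : ContDiff ℝ ∞ ξ := contDiff_pi.2 fun i => by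
    by_cases hi : i = 0
    · simp only [hi, if_true, ξ]; exact hG
    · simp only [hi, if_false, ξ]; exact sm_coord i
  have hξd : ∀ z v i, fderiv ℝ ξ z v i = if i = 0 then fderiv ℝ G z v else v i := by
    intro z v i
    have h1 : HasFDerivAt (fun z => ξ z i) ((pr i).comp (fderiv ℝ ξ z)) z :=
      (pr i).hasFDerivAt.comp z (hξ.differentiable (by simp) z).hasFDerivAt
    have h2 : fderiv ℝ (fun z => ξ z i) z v = fderiv ℝ ξ z v i := by rw [h1.fderiv]; rfl
    rw [← h2]
    by_cases hi : i = 0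
    · simp only [hi, if_true, ξ]
    · simp only [hi, if_false, ξ]
      have : HasFDerivAt (fun y : Pt => y i) (pr i) z := (pr i).hasFDerivAt
      rw [this.fderiv]; rfl
  have hξ0 : ξ 0 = 0 := by
    ext i; simp [ξ, hG0]
  obtain ⟨e, he⟩ := equiv_of_inj (fderiv ℝ ξ 0) (fun v hv => by
    have a0 := congrFun hv 0
    have a1 := congrFun hv 1
    have a2 := congrFun hv 2
    have a3 := congrFun hv 3
    rw [hξd] at a0 a1 a2 a3
    simp at a0 a1 a2 a3
    rw [hGd.self_of_nhds, hh0, a2] at a0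
    ext i
    fin_cases i
    · simpa using a0
    · exact a1
    · exact a2
    · exact a3)
  obtain ⟨η, hη, hη0, -, hηe⟩ := invgerm ξ hξ 0 e (by
    rw [he]; exact (hξ.differentiable (by simp) 0).hasFDerivAt)
  rw [hξ0] at hη0 hηe
  have hηd : ∀ᶠ y in 𝓝 (0 : Pt), ∀ v, fderiv ℝ ξ (η y) (fderiv ℝ η y v) = v := by
    filter_upwards [hηe.eventually_nhds] with y hy v
    have h1 : HasFDerivAt (fun y => ξ (η y)) _ y := (hξ.differentiable (by simp) (η y)).hasFDerivAt.comp y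
      (hη.differentiable (by simp) y).hasFDerivAt
    have h2 : fderiv ℝ (fun y => ξ (η y)) y = fderiv ℝ (fun y => y) y := Filter.EventuallyEq.fderiv_eq hy
    rw [h1.fderiv] at h2
    have := congrArg (fun A : Pt →L[ℝ] Pt => A v) h2
    simpa using this
  have hcd : ∀ y v, fderiv ℝ (fun y => Φ (η y)) y v = fderiv ℝ Φ (η y) (fderiv ℝ η y v) := by
    intro y v
    have h1 : HasFDerivAt (fun y => Φ (η y)) _ y := (hΦ.differentiable (by simp) (η y)).hasFDerivAt.comp y
      (hη.differentiable (by simp) y).hasFDerivAt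
    rw [h1.fderiv]; rfl
  have tη : Tendsto η (𝓝 0) (𝓝 0) := by
    have := hη.continuous.tendsto 0
    rwa [hη0] at this
  have tP : Tendsto (fun z => x₀ + P z) (𝓝 0) (𝓝 x₀) := by
    have : Continuous (fun z => x₀ + P z) := by fun_prop
    have := this.tendsto 0
    simpa using this
  refine ⟨fun y => Φ (η y), hΦ.comp hη, by simp only [hη0, hΦ0], ?_, ?_⟩
  · intro v hv
    rw [hcd, hη0] at hv
    have h1 := hinj _ hv
    have h2 := hηd.self_of_nhds v
    rw [h1, map_zero] at h2
    exact h2.symm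
  · filter_upwards [hηd, tη.eventually hΦe, tη.eventually hGd, tη.eventually (tP.eventually hsk')] with y h1 h2 h3 h4 v w
    rw [hcd, hcd, h2, hP (fderiv ℝ η y v), hP (fderiv ℝ η y w)]
    have pp : bilL (b (x₀ + P (η y))) p p = 0 := by have := h4 p p; linarith
    have qq : bilL (b (x₀ + P (η y))) q q = 0 := by have := h4 q q; linarith
    simp only [map_add, map_smul, add_apply, smul_apply, smul_eq_mul]
    rw [h4 q p, pp, qq]
    have v0 := congrFun (h1 v) 0
    have v2 := congrFun (h1 v) 2
    have w0 := congrFun (h1 w) 0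
    have w2 := congrFun (h1 w) 2
    rw [hξd] at v0 v2 w0 w2
    simp at v0 v2 w0 w2
    rw [h3, v2] at v0
    rw [h3, w2] at w0
    rw [v2, w2]
    have : bilL (b (x₀ + P (η y))) p q = h (η y) := rfl
    rw [this]
    linear_combination w 2 * v0 - v 2 * w0

end Straight


section Pull

lemma fderiv_comp_i {ξ : Pt → Pt} (hξ : ContDiff ℝ ∞ ξ) (z v : Pt) (i : Fin 4) :
    fderiv ℝ ξ z v i = fderiv ℝ (fun z => ξ z i) z v := by
  have h1 : HasFDerivAt (fun z => ξ z i)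
      ((ContinuousLinearMap.proj (R := ℝ) (φ := fun _ : Fin 4 => ℝ) i).comp (fderiv ℝ ξ z)) z :=
    (ContinuousLinearMap.proj (R := ℝ) (φ := fun _ : Fin 4 => ℝ) i).hasFDerivAt.comp z
      (hξ.differentiable (by simp) z).hasFDerivAt
  rw [h1.fderiv]; rfl

lemma pull2_eq {φ : Pt → Pt} (hφ : ContDiff ℝ ∞ φ) (A : Form2) (u : Pt) (i j : Fin 4) :
    pull2 φ A u i j = bilL (A (φ u)) (fderiv ℝ φ u (Pi.single i 1)) (fderiv ℝ φ u (Pi.single j 1)) := by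
  rw [bilL_apply]
  unfold pull2
  simp only [fderiv_comp_i hφ, pd]

lemma D2_symm {Φ : Pt → Pt} (hΦ : ContDiff ℝ ∞ Φ) (y u v : Pt) :
    fderiv ℝ (fderiv ℝ Φ) y u v = fderiv ℝ (fderiv ℝ Φ) y v u :=
  (hΦ.contDiffAt (x := y)).isSymmSndFDerivAt
    (by simp only [minSmoothness_of_isRCLikeNormedField]; exact WithTop.coe_le_coe.2 (le_top : (2 : ℕ∞) ≤ ⊤)) u v

lemma hasD {Φ : Pt → Pt} (hΦ : ContDiff ℝ ∞ Φ) (y v : Pt) :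
    HasFDerivAt (fun y => fderiv ℝ Φ y v) ((fderiv ℝ (fderiv ℝ Φ) y).flip v) y := by
  have hd : DifferentiableAt ℝ (fderiv ℝ Φ) y :=
    (hΦ.fderiv_right (m := ∞) (by simp)).differentiable (by simp) y
  have := hd.hasFDerivAt.clm_apply (hasFDerivAt_const v y)
  rw [ContinuousLinearMap.comp_zero, zero_add] at this
  exact this

lemma pd_pull2 {Φ : Pt → Pt} (hΦ : ContDiff ℝ ∞ Φ) {F : Pt → Pt →L[ℝ] Pt →L[ℝ] ℝ} (hF : ContDiff ℝ ∞ F)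
    (y u v : Pt) (k : Fin 4) :
    pd k (fun y => F (Φ y) (fderiv ℝ Φ y u) (fderiv ℝ Φ y v)) y =
      fderiv ℝ F (Φ y) (fderiv ℝ Φ y (Pi.single k 1)) (fderiv ℝ Φ y u) (fderiv ℝ Φ y v)
      + F (Φ y) (fderiv ℝ (fderiv ℝ Φ) y (Pi.single k 1) u) (fderiv ℝ Φ y v)
      + F (Φ y) (fderiv ℝ Φ y u) (fderiv ℝ (fderiv ℝ Φ) y (Pi.single k 1) v) := by
  have h1 : HasFDerivAt (fun y => F (Φ y)) _ y := (hF.differentiable (by simp) (Φ y)).hasFDerivAt.comp y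
      (hΦ.differentiable (by simp) y).hasFDerivAt
  have h2 := (h1.clm_apply (hasD hΦ y u)).clm_apply (hasD hΦ y v)
  unfold pd
  rw [h2.fderiv]
  simp; ring

lemma pd_pull1 {Φ : Pt → Pt} (hΦ : ContDiff ℝ ∞ Φ) {F : Pt → Pt →L[ℝ] ℝ} (hF : ContDiff ℝ ∞ F)
    (y u : Pt) (k : Fin 4) :
    pd k (fun y => F (Φ y) (fderiv ℝ Φ y u)) y =
      fderiv ℝ F (Φ y) (fderiv ℝ Φ y (Pi.single k 1)) (fderiv ℝ Φ y u)
      + F (Φ y) (fderiv ℝ (fderiv ℝ Φ) y (Pi.single k 1) u) := by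
  have h1 : HasFDerivAt (fun y => F (Φ y)) _ y := (hF.differentiable (by simp) (Φ y)).hasFDerivAt.comp y
      (hΦ.differentiable (by simp) y).hasFDerivAt
  have h2 := h1.clm_apply (hasD hΦ y u)
  unfold pd
  rw [h2.fderiv]
  simp; ring

lemma cov_smooth {o : Form1} (ho : ContDiff ℝ ∞ o) : ContDiff ℝ ∞ (fun x => covL (o x)) :=
  covL.contDiff.comp ho

lemma cov_fderiv {o : Form1} (ho : ContDiff ℝ ∞ o) (x u v : Pt) :
    fderiv ℝ (fun x => covL (o x)) x u v = ∑ i, ∑ j, pd i (fun y => o y j) x * u i * v j := by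
  have h1 : HasFDerivAt (fun x => covL (o x)) _ x :=
    covL.hasFDerivAt.comp x (ho.differentiable (by simp) x).hasFDerivAt
  rw [h1.fderiv, ContinuousLinearMap.comp_apply, covL_apply, Finset.sum_comm]
  refine Finset.sum_congr rfl fun i _ => ?_
  rw [fderiv_comp_i (ξ := o) ho, fderiv_eq_sum, Finset.sum_mul]
  refine Finset.sum_congr rfl fun j _ => ?_
  ring

lemma cov_d1 {o : Form1} (ho : ContDiff ℝ ∞ o) (x u v : Pt) :
    fderiv ℝ (fun x => covL (o x)) x u v - fderiv ℝ (fun x => covL (o x)) x v u = bilL (d1 o x) u v := by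
  rw [cov_fderiv ho, cov_fderiv ho, bilL_apply, Finset.sum_comm (f := fun i j => pd i (fun y => o y j) x * v i * u j),
    ← Finset.sum_sub_distrib]
  refine Finset.sum_congr rfl fun i _ => ?_
  rw [← Finset.sum_sub_distrib]
  refine Finset.sum_congr rfl fun j _ => ?_
  unfold d1
  ring

lemma d1_smooth {o : Form1} (ho : ContDiff ℝ ∞ o) : ContDiff ℝ ∞ (d1 o) :=
  contDiff_pi.2 fun i => contDiff_pi.2 fun j =>
    (sm_pd (contDiff_pi.1 ho j) i).sub (sm_pd (contDiff_pi.1 ho i) j)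

lemma d2_d1 {o : Form1} (ho : ContDiff ℝ ∞ o) (x : Pt) (i j k : Fin 4) : d2 (d1 o) x i j k = 0 := by
  have c := fun i => contDiff_pi.1 ho i
  have e : ∀ l i j, pd l (fun y => d1 o y i j) x =
      pd l (pd i (fun y => o y j)) x - pd l (pd j (fun y => o y i)) x := fun l i j =>
    pd_sub (f := pd i (fun y => o y j)) (g := pd j (fun y => o y i)) (sm_pd (c j) i) (sm_pd (c i) j) l x
  unfold d2
  rw [e, e, e, pd_comm (c k) i j, pd_comm (c j) i k, pd_comm (c i) j k]
  ring

lemma bil_sum (B : Pt →L[ℝ] Pt →L[ℝ] ℝ) (A : Pt →L[ℝ] Pt) (v w : Pt) :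
    B (A v) (A w) = ∑ i, ∑ j, v i * w j * B (A (Pi.single i 1)) (A (Pi.single j 1)) := by
  conv_lhs => rw [pi_eq_sum_univ' v, pi_eq_sum_univ' w]
  simp only [map_sum, map_smul, sum_apply, smul_apply, smul_eq_mul, Finset.mul_sum]
  rw [Finset.sum_comm]
  refine Finset.sum_congr rfl fun i _ => Finset.sum_congr rfl fun j _ => ?_
  ring

lemma step_core (Ω : Form2) (hΩ : ContDiff ℝ ∞ Ω) (o : Form1) (ho : ContDiff ℝ ∞ o) (x₀ : Pt)
    (hsk : ∀ᶠ x in 𝓝 x₀, ∀ i j, Ω x i j = - Ω x j i)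
    (hd : ∀ᶠ x in 𝓝 x₀, w12 o Ω x = d2 Ω x)
    (Φ : Pt → Pt) (hΦ : ContDiff ℝ ∞ Φ) (hΦ0 : Φ 0 = x₀)
    (hB : ∀ᶠ z in 𝓝 (0 : Pt), ∀ v w, bilL (d1 o (Φ z)) (fderiv ℝ Φ z v) (fderiv ℝ Φ z w) =
        v 0 * w 2 - v 2 * w 0) :
    ∃ f X2 X4 : Pt → ℝ, ContDiff ℝ ∞ f ∧ ContDiff ℝ ∞ X2 ∧ ContDiff ℝ ∞ X4 ∧
      f 0 = 0 ∧ X2 0 = 0 ∧ X4 0 = 0 ∧ ∀ᶠ y in 𝓝 (0 : Pt), ∀ v w,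
        bilL (Ω (Φ y)) (fderiv ℝ Φ y v) (fderiv ℝ Φ y w) = Real.exp (f y) *
        (Real.exp ((1 + y 0) * y 2) * (v 0 * fderiv ℝ X2 y w - w 0 * fderiv ℝ X2 y v)
          + (v 2 * fderiv ℝ X4 y w - w 2 * fderiv ℝ X4 y v)) := by
  have hF := bil_smooth hΩ
  have hc := cov_smooth ho
  have hΦ' : ∀ v, ContDiff ℝ ∞ (fun y => fderiv ℝ Φ y v) := fun v =>
    (hΦ.fderiv_right (m := ∞) (by simp)).clm_apply contDiff_const
  have tΦ : Tendsto Φ (𝓝 0) (𝓝 x₀) := by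
    have := hΦ.continuous.tendsto 0
    rwa [hΦ0] at this
  have hd' : ∀ᶠ x in 𝓝 x₀, ∀ u v w, fderiv ℝ (fun x => bilL (Ω x)) x u v w
      - fderiv ℝ (fun x => bilL (Ω x)) x v u w + fderiv ℝ (fun x => bilL (Ω x)) x w u v =
      covL (o x) u * bilL (Ω x) v w - covL (o x) v * bilL (Ω x) u w + covL (o x) w * bilL (Ω x) u v := by
    filter_upwards [hd] with x hx u v w
    have := alt3b (fderiv ℝ (fun x => bilL (Ω x)) x) ((covL (o x)).smulRight (bilL (Ω x))) (fun i j k => by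
      have h1 := congrFun (congrFun (congrFun hx i) j) k
      simp only [w12, d2] at h1
      simp only [ContinuousLinearMap.smulRight_apply, smul_apply, smul_eq_mul, covL_single,
        bilL_single, bil_fderiv hΩ]
      linarith) u v w
    simp only [ContinuousLinearMap.smulRight_apply, smul_apply, smul_eq_mul] at this
    linarith
  obtain ⟨f, X2, X4, hf, hX2, hX4, hf0, hX20, hX40, he⟩ := core
    (fun i j y => bilL (Ω (Φ y)) (fderiv ℝ Φ y (Pi.single i 1)) (fderiv ℝ Φ y (Pi.single j 1)))
    (fun i j => ((hF.comp hΦ).clm_apply (hΦ' _)).clm_apply (hΦ' _))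
    (fun i y => covL (o (Φ y)) (fderiv ℝ Φ y (Pi.single i 1)))
    (fun i => (hc.comp hΦ).clm_apply (hΦ' _))
    (by
      filter_upwards [tΦ.eventually hsk] with y hy i j
      exact bilL_skew hy _ _)
    (by
      filter_upwards [hB] with y hy i j
      have h1 := pd_pull1 hΦ hc y (Pi.single j 1) i
      have h2 := pd_pull1 hΦ hc y (Pi.single i 1) j
      rw [h1, h2, D2_symm hΦ y (Pi.single j 1)]
      have h3 := cov_d1 ho (Φ y) (fderiv ℝ Φ y (Pi.single i 1)) (fderiv ℝ Φ y (Pi.single j 1))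
      rw [hy] at h3
      have h4 : (Pi.single i 1 : Pt) 0 * (Pi.single j 1 : Pt) 2 - (Pi.single i 1 : Pt) 2 * (Pi.single j 1 : Pt) 0
        = dxw 0 2 i j := by
        fin_cases i <;> fin_cases j <;> simp [dxw]
      rw [← h4, ← h3]
      ring)
    (by
      filter_upwards [tΦ.eventually hsk, tΦ.eventually hd'] with y hy hy2 i j k
      rw [pd_pull2 hΦ hF, pd_pull2 hΦ hF, pd_pull2 hΦ hF, ← hy2, D2_symm hΦ y (Pi.single j 1) (Pi.single i 1),
        D2_symm hΦ y (Pi.single k 1) (Pi.single i 1), D2_symm hΦ y (Pi.single k 1) (Pi.single j 1)]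
      rw [bilL_skew hy (fderiv ℝ Φ y (Pi.single j 1))
        (fderiv ℝ (fderiv ℝ Φ) y (Pi.single i 1) (Pi.single k 1))]
      ring)
  refine ⟨f, X2, X4, hf, hX2, hX4, hf0, hX20, hX40, ?_⟩
  filter_upwards [he] with y hy v w
  rw [bil_sum (bilL (Ω (Φ y))) (fderiv ℝ Φ y) v w]
  simp only [hy, fderiv_eq_sum, Fin.sum_univ_four]
  simp
  ring

lemma main_global (Ω : Form2) (hΩ : ContDiff ℝ ∞ Ω) (o : Form1) (ho : ContDiff ℝ ∞ o) (x₀ : Pt)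
    (hsk : ∀ᶠ x in 𝓝 x₀, ∀ i j, Ω x i j = - Ω x j i)
    (hd : ∀ᶠ x in 𝓝 x₀, w12 o Ω x = d2 Ω x)
    (hr : pf (Ω x₀) ≠ 0) (hcl : ∀ᶠ x in 𝓝 x₀, classAt o x = 3) :
    ∃ (φ : Pt → Pt) (f : Pt → ℝ) (e : Pt ≃L[ℝ] Pt), ContDiff ℝ ∞ φ ∧ ContDiff ℝ ∞ f ∧
      φ 0 = x₀ ∧ f 0 = 0 ∧ HasFDerivAt φ (e : Pt →L[ℝ] Pt) 0 ∧
      ∀ᶠ u in 𝓝 (0 : Pt), ∀ i j, pull2 φ Ω u i j = Real.exp (f u) *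
          (Real.exp ((1 + u 0) * u 2) * dxw 0 1 i j + dxw 2 3 i j) := by
  obtain ⟨Φ, hΦ, hΦ0, hinj, hB⟩ := straight (d1 o) (d1_smooth ho) x₀
    (Eventually.of_forall fun x => d1_skew o x) (hcl.mono fun x hx => class_pf hx)
    (Eventually.of_forall fun x => d2_d1 ho x) (class_ne hcl.self_of_nhds)
  obtain ⟨f, X2, X4, hf, hX2, hX4, hf0, hX20, hX40, he⟩ := step_core Ω hΩ o ho x₀ hsk hd Φ hΦ hΦ0 hB
  obtain ⟨E, hE⟩ := equiv_of_inj _ hinj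
  let χ : Pt → Pt := fun y => ![y 0, X2 y, y 2, X4 y]
  have hχ : ContDiff ℝ ∞ χ := contDiff_pi.2 fun i => by
    fin_cases i
    · exact sm_coord 0
    · exact hX2
    · exact sm_coord 2
    · exact hX4
  have hco : ∀ (i : Fin 4) (z v : Pt), fderiv ℝ (fun y : Pt => y i) z v = v i := fun i z v => by
    have : HasFDerivAt (fun y : Pt => y i) (ContinuousLinearMap.proj (R := ℝ) (φ := fun _ : Fin 4 => ℝ) i) z :=
      (ContinuousLinearMap.proj (R := ℝ) (φ := fun _ : Fin 4 => ℝ) i).hasFDerivAt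
    rw [this.fderiv]; rfl
  have hχ0' : ∀ z v, fderiv ℝ χ z v 0 = v 0 := fun z v => by rw [fderiv_comp_i hχ]; exact hco 0 z v
  have hχ1' : ∀ z v, fderiv ℝ χ z v 1 = fderiv ℝ X2 z v := fun z v => by rw [fderiv_comp_i hχ]; rfl
  have hχ2' : ∀ z v, fderiv ℝ χ z v 2 = v 2 := fun z v => by rw [fderiv_comp_i hχ]; exact hco 2 z v
  have hχ3' : ∀ z v, fderiv ℝ χ z v 3 = fderiv ℝ X4 z v := fun z v => by rw [fderiv_comp_i hχ]; rfl
  have hχ0 : χ 0 = 0 := by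
    ext i; fin_cases i <;> simp [χ, hX20, hX40]
  obtain ⟨C, hC⟩ := equiv_of_inj (fderiv ℝ χ 0) (fun v hv => by
    have a0 := congrFun hv 0
    have a1 := congrFun hv 1
    have a2 := congrFun hv 2
    have a3 := congrFun hv 3
    rw [hχ0'] at a0
    rw [hχ1'] at a1
    rw [hχ2'] at a2
    rw [hχ3'] at a3
    have h0 := he.self_of_nhds v
    rw [a0, a1, a2, a3, hΦ0] at h0
    refine hinj v (pf_nondeg hsk.self_of_nhds hr _ fun j => ?_)
    have h1 := h0 (E.symm (Pi.single j 1))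
    rw [← hE] at h1 ⊢
    simp only [ContinuousLinearEquiv.coe_coe, ContinuousLinearEquiv.apply_symm_apply] at h1 ⊢
    rw [bilL_apply] at h1
    simpa [Pi.single_apply] using h1)
  obtain ⟨ρ, hρ, hρ0, -, hρe⟩ := invgerm χ hχ 0 C (by
    rw [hC]; exact (hχ.differentiable (by simp) 0).hasFDerivAt)
  rw [hχ0] at hρ0 hρe
  have hρd : ∀ᶠ y in 𝓝 (0 : Pt), ∀ v, fderiv ℝ χ (ρ y) (fderiv ℝ ρ y v) = v := by
    filter_upwards [hρe.eventually_nhds] with y hy v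
    have h1 : HasFDerivAt (fun y => χ (ρ y)) _ y := (hχ.differentiable (by simp) (ρ y)).hasFDerivAt.comp y
      (hρ.differentiable (by simp) y).hasFDerivAt
    have h2 : fderiv ℝ (fun y => χ (ρ y)) y = fderiv ℝ (fun y => y) y := Filter.EventuallyEq.fderiv_eq hy
    rw [h1.fderiv] at h2
    have := congrArg (fun A : Pt →L[ℝ] Pt => A v) h2
    simpa using this
  have hφ : ContDiff ℝ ∞ (fun y => Φ (ρ y)) := hΦ.comp hρ
  have hcd : ∀ y v, fderiv ℝ (fun y => Φ (ρ y)) y v = fderiv ℝ Φ (ρ y) (fderiv ℝ ρ y v) := by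
    intro y v
    have h1 : HasFDerivAt (fun y => Φ (ρ y)) _ y := (hΦ.differentiable (by simp) (ρ y)).hasFDerivAt.comp y
      (hρ.differentiable (by simp) y).hasFDerivAt
    rw [h1.fderiv]; rfl
  have tρ : Tendsto ρ (𝓝 0) (𝓝 0) := by
    have := hρ.continuous.tendsto 0
    rwa [hρ0] at this
  obtain ⟨e, hee⟩ := equiv_of_inj (fderiv ℝ (fun y => Φ (ρ y)) 0) (fun v hv => by
    rw [hcd, hρ0] at hv
    have h1 := hinj _ hv
    have h2 := hρd.self_of_nhds v
    rw [h1, map_zero] at h2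
    exact h2.symm)
  refine ⟨fun y => Φ (ρ y), fun y => f (ρ y), e, hφ, hf.comp hρ, by simp only [hρ0, hΦ0],
    by simp only [hρ0, hf0], by rw [hee]; exact (hφ.differentiable (by simp) 0).hasFDerivAt, ?_⟩
  filter_upwards [hρe, hρd, tρ.eventually he] with u h1 h2 h3 i j
  rw [pull2_eq hφ, hcd, hcd, h3]
  have u0 : ρ u 0 = u 0 := congrFun h1 0
  have u2 : ρ u 2 = u 2 := congrFun h1 2
  have q0 : ∀ i, fderiv ℝ ρ u (Pi.single i 1) 0 = (Pi.single i 1 : Pt) 0 := fun i => by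
    rw [← hχ0' (ρ u) (fderiv ℝ ρ u (Pi.single i 1)), h2]
  have q1 : ∀ i, fderiv ℝ X2 (ρ u) (fderiv ℝ ρ u (Pi.single i 1)) = (Pi.single i 1 : Pt) 1 := fun i => by
    rw [← hχ1' (ρ u), h2]
  have q2 : ∀ i, fderiv ℝ ρ u (Pi.single i 1) 2 = (Pi.single i 1 : Pt) 2 := fun i => by
    rw [← hχ2' (ρ u) (fderiv ℝ ρ u (Pi.single i 1)), h2]
  have q3 : ∀ i, fderiv ℝ X4 (ρ u) (fderiv ℝ ρ u (Pi.single i 1)) = (Pi.single i 1 : Pt) 3 := fun i => by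
    rw [← hχ3' (ρ u), h2]
  rw [q0, q0, q1, q1, q2, q2, q3, q3, u0, u2]
  fin_cases i <;> fin_cases j <;> simp [dxw]

end Pull


section Fin

lemma pf_w22 {A : Form2} {x : Pt} (hb : ∀ i j, A x i j = - A x j i) (h : w22 A A x ≠ 0) : pf (A x) ≠ 0 := by
  intro h0
  refine h ?_
  have s00 := hb 0 0
  have s11 := hb 1 1
  have s22 := hb 2 2
  have s33 := hb 3 3
  have r00 : A x 0 0 = 0 := by linarith
  have r11 : A x 1 1 = 0 := by linarith
  have r22 : A x 2 2 = 0 := by linarith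
  have r33 : A x 3 3 = 0 := by linarith
  have s01 := hb 1 0
  have s02 := hb 2 0
  have s03 := hb 3 0
  have s12 := hb 2 1
  have s13 := hb 3 1
  have s23 := hb 3 2
  clear hb h s00 s11 s22 s33
  unfold pf at h0
  ext i j k l
  unfold w22
  fin_cases i <;> fin_cases j <;> fin_cases k <;> fin_cases l <;>
    simp only [Fin.zero_eta, Fin.mk_one, Fin.reduceFinMk, r00, r11, r22, r33, s01, s02, s03, s12, s13, s23,
      Pi.zero_apply] <;>
    first | ring1 | linear_combination 2 * h0 | linear_combination (-2) * h0

lemma d1_congr {o o' : Form1} {x : Pt} (h : ∀ᶠ y in 𝓝 x, o y = o' y) : d1 o x = d1 o' x := by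
  ext i j
  unfold d1
  rw [pd_congr (h.mono fun y hy => congrFun hy j) i, pd_congr (h.mono fun y hy => congrFun hy i) j]

lemma d2_congr {A A' : Form2} {x : Pt} (h : ∀ᶠ y in 𝓝 x, A y = A' y) : d2 A x = d2 A' x := by
  ext i j k
  unfold d2
  have c : ∀ j k, ∀ᶠ y in 𝓝 x, A y j k = A' y j k := fun j k => h.mono fun y hy => by rw [hy]
  rw [pd_congr (c j k) i, pd_congr (c i k) j, pd_congr (c i j) k]

end Fin


end Helpers

/-- Theorem `Type3`. A germ of a rank-4 2-form of type 3 at `x₀` has,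
in suitable local coordinates centred at `x₀`, the form
`Ω = exp(f)·( exp((1+x¹)x³) dx¹∧dx² + dx³∧dx⁴ )` with `f(0) = 0`. -/
theorem type3_normal_form (W : Set Pt) (hW : IsOpen W) (x₀ : Pt) (hx₀ : x₀ ∈ W)
    (Ω : Form2) (hΩs : ContDiffOn ℝ (⊤ : ℕ∞) Ω W)
    (hΩa : ∀ x ∈ W, ∀ i j, Ω x i j = - Ω x j i)
    (hΩr : ∀ x ∈ W, w22 Ω Ω x ≠ 0)
    (ω : Form1) (hωs : ContDiffOn ℝ (⊤ : ℕ∞) ω W)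
    (hω : ∀ x ∈ W, w12 ω Ω x = d2 Ω x)
    (htype : IsTypeAt ω 3 x₀) :
    ∃ (U V : Set Pt) (φ ψ : Pt → Pt) (f : Pt → ℝ),
      IsOpen U ∧ IsOpen V ∧ (0 : Pt) ∈ U ∧ x₀ ∈ V ∧ V ⊆ W ∧ φ 0 = x₀ ∧
      Set.MapsTo φ U V ∧ Set.MapsTo ψ V U ∧
      (∀ u ∈ U, ψ (φ u) = u) ∧ (∀ y ∈ V, φ (ψ y) = y) ∧
      ContDiffOn ℝ (⊤ : ℕ∞) φ U ∧ ContDiffOn ℝ (⊤ : ℕ∞) ψ V ∧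
      ContDiffOn ℝ (⊤ : ℕ∞) f U ∧ f 0 = 0 ∧
      ∀ u ∈ U, ∀ i j, pull2 φ Ω u i j =
        Real.exp (f u) *
          (Real.exp ((1 + u 0) * u 2) * dxw 0 1 i j + dxw 2 3 i j) := by
  obtain ⟨Ω', hΩ', eΩ⟩ := cutoff Ω W hW x₀ hx₀ hΩs
  obtain ⟨ω', hω', eω⟩ := cutoff ω W hW x₀ hx₀ hωs
  have hWn : ∀ᶠ x in nhds x₀, x ∈ W := hW.mem_nhds hx₀
  have hsk : ∀ᶠ x in nhds x₀, ∀ i j, Ω' x i j = - Ω' x j i := by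
    filter_upwards [eΩ, hWn] with x h1 h2 i j
    rw [h1]
    exact hΩa x h2 i j
  have hd : ∀ᶠ x in nhds x₀, w12 ω' Ω' x = d2 Ω' x := by
    filter_upwards [eΩ, eΩ.eventually_nhds, eω, hWn] with x h1 h2 h3 h4
    rw [d2_congr h2, ← hω x h4]
    unfold w12
    rw [h1, h3]
  have hr : pf (Ω' x₀) ≠ 0 := by
    rw [eΩ.self_of_nhds]
    exact pf_w22 (hΩa x₀ hx₀) (hΩr x₀ hx₀)
  have hcl : ∀ᶠ x in nhds x₀, classAt ω' x = 3 := by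
    filter_upwards [eω, eω.eventually_nhds, htype.2] with x h1 h2 h3
    rw [← h3]
    unfold classAt
    rw [h1, d1_congr h2]
  obtain ⟨φ, f, A, hφ, hf, hφ0, hf0, hφd, hform⟩ := main_global Ω' hΩ' ω' hω' x₀ hsk hd hr hcl
  obtain ⟨e, he, h0e, hes⟩ := invfun φ hφ 0 A hφd
  have tφ : Tendsto φ (nhds 0) (nhds x₀) := by
    have := hφ.continuous.tendsto 0
    rwa [hφ0] at this
  obtain ⟨N, hN, hNo, h0N⟩ := mem_nhds_iff.1 (hform.and ((tφ.eventually eΩ).and (tφ.eventually hWn)))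
  have hsrc : ∀ u, u ∈ (e.restrOpen N hNo).source ↔ u ∈ e.source ∧ u ∈ N := fun u => Iff.rfl
  have hφe : ∀ u, (e.restrOpen N hNo) u = φ u := fun u => congrFun he u
  have hsub : (e.restrOpen N hNo).target ⊆ e.target := fun y hy => by
    have h1 := (e.restrOpen N hNo).map_target hy
    have h2 := (e.restrOpen N hNo).right_inv hy
    have h3 := e.map_source ((hsrc _).1 h1).1
    have h4 : e ((e.restrOpen N hNo).symm y) = y := h2
    rwa [h4] at h3
  refine ⟨(e.restrOpen N hNo).source, (e.restrOpen N hNo).target, φ, (e.restrOpen N hNo).symm, f,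
    (e.restrOpen N hNo).open_source, (e.restrOpen N hNo).open_target, ⟨h0e, h0N⟩, ?_, ?_, hφ0,
    ?_, ?_, ?_, ?_, hφ.contDiffOn, ?_, hf.contDiffOn, hf0, ?_⟩
  · have h1 := (e.restrOpen N hNo).map_source (x := 0) ⟨h0e, h0N⟩
    rwa [hφe, hφ0] at h1
  · intro y hy
    have h1 := (e.restrOpen N hNo).map_target hy
    have h2 := (e.restrOpen N hNo).right_inv hy
    have h3 := (hN ((hsrc _).1 h1).2).2.2
    rw [hφe] at h2
    rwa [h2] at h3
  · intro u hu
    have h1 := (e.restrOpen N hNo).map_source hu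
    rwa [hφe] at h1
  · intro y hy
    exact (e.restrOpen N hNo).map_target hy
  · intro u hu
    have h1 := (e.restrOpen N hNo).left_inv hu
    rwa [hφe] at h1
  · intro y hy
    have h1 := (e.restrOpen N hNo).right_inv hy
    rwa [hφe] at h1
  · exact hes.mono hsub
  · intro u hu i j
    have h1 := hN ((hsrc _).1 hu).2
    rw [← h1.1 i j]
    unfold pull2
    rw [h1.2.1]
end

section
/- Let V be a 4-dimensional real vector space, let Ω be a nondegenerate alternating bilinear form on V, and let B be an alternating bilinear form on V satisfying B∧Ω = 0 (as an element of Λ⁴V*). Let A : V → V be the unique endomorphism with B(X,Y) = Ω(AX,Y) for all X,Y ∈ V. Then B(X,Y) = Ω(X,AY) for all X,Y, and det(λ·id − A) = (λ² + c)², where c ∈ ℝ is defined by c·Ω∧Ω = B∧B. (Applied pointwise to B = dω_Ω, this says that the endomorphism A_Ω defined by dω_Ω(X,Y) = Ω(A_Ω X,Y) = Ω(X,A_Ω Y) has characteristic polynomial (λ² + I(Ω))², where I(Ω)·Ω∧Ω = dω_Ω∧dω_Ω.) -/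
/-- The components of the 4-form `A ∧ B` for alternating bilinear forms `A`, `B` on a
4-dimensional space, evaluated on four vectors (Λ⁴-shuffle expression). -/
def wedge22Eval {V : Type*} [AddCommGroup V] [Module ℝ V]
    (A B : LinearMap.BilinForm ℝ V) (w x y z : V) : ℝ :=
  A w x * B y z - A w y * B x z + A w z * B x y
    + A x y * B w z - A x z * B w y + A y z * B w x

lemma det_alt_four (M : Matrix (Fin 4) (Fin 4) ℝ) (hd : ∀ i, M i i = 0)
    (hs : ∀ i j, M j i = - M i j) :
    M.det = (M 0 1 * M 2 3 - M 0 2 * M 1 3 + M 0 3 * M 1 2) ^ 2 := by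
  have e10 := hs 0 1
  have e20 := hs 0 2
  have e30 := hs 0 3
  have e21 := hs 1 2
  have e31 := hs 1 3
  have e32 := hs 2 3
  have d0 := hd 0
  have d1 := hd 1
  have d2 := hd 2
  have d3 := hd 3
  rw [Matrix.det_succ_row_zero]
  simp [Fin.sum_univ_succ, Matrix.det_fin_three, Fin.succAbove, Matrix.submatrix_apply,
    d0, d1, d2, d3, e10, e20, e30, e21, e31, e32]
  ring

/-- Let `V` be a 4-dimensional real vector space, `Ω` a nondegenerate
alternating bilinear form, `B` an alternating bilinear form with `B ∧ Ω = 0` in `Λ⁴V*`,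
and `A` the (unique) endomorphism with `B(X,Y) = Ω(AX,Y)`. Then `B(X,Y) = Ω(X,AY)` and
`det(λ·id − A) = (λ² + c)²`, where `c` is defined by `c·Ω∧Ω = B∧B`. -/
theorem charpoly_of_skew_pair
    (V : Type*) [AddCommGroup V] [Module ℝ V] [FiniteDimensional ℝ V]
    (hdim : Module.finrank ℝ V = 4)
    (Ω B : LinearMap.BilinForm ℝ V)
    (hΩalt : Ω.IsAlt) (hBalt : B.IsAlt) (hΩnd : Ω.Nondegenerate)
    (hBΩ : ∀ w x y z : V, wedge22Eval B Ω w x y z = 0)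
    (A : V →ₗ[ℝ] V) (hA : ∀ X Y : V, B X Y = Ω (A X) Y)
    (c : ℝ) (hc : ∀ w x y z : V, c * wedge22Eval Ω Ω w x y z = wedge22Eval B B w x y z) :
    (∀ X Y : V, B X Y = Ω X (A Y)) ∧
    ∀ lam : ℝ, LinearMap.det (lam • (LinearMap.id : V →ₗ[ℝ] V) - A) = (lam ^ 2 + c) ^ 2 := by
  refine ⟨fun X Y => ?_, fun lam => ?_⟩
  · rw [← hBalt.neg_eq Y X, hA, hΩalt.neg_eq]
  let b : Module.Basis (Fin 4) ℝ V := Module.finBasisOfFinrankEq ℝ V hdim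
  have hneg : ∀ {F : LinearMap.BilinForm ℝ V}, F.IsAlt →
      (LinearMap.BilinForm.toMatrix b F).det =
        (F (b 0) (b 1) * F (b 2) (b 3) - F (b 0) (b 2) * F (b 1) (b 3)
          + F (b 0) (b 3) * F (b 1) (b 2)) ^ 2 := by
    intro F hF
    rw [det_alt_four]
    · simp only [LinearMap.BilinForm.toMatrix_apply]
    · intro i
      simp only [LinearMap.BilinForm.toMatrix_apply]
      exact hF _
    · intro i j
      simp only [LinearMap.BilinForm.toMatrix_apply]
      exact (hF.neg_eq _ _).symm
  have hCalt : (lam • Ω - B).IsAlt := by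
    intro x
    simp [hΩalt x, hBalt x]
  have hC : lam • Ω - B = Ω.compLeft (lam • (LinearMap.id : V →ₗ[ℝ] V) - A) := by
    ext X Y
    simp [hA]
  have h1 := hneg hCalt
  have h2 := hneg hΩalt
  have hnz := (LinearMap.BilinForm.nondegenerate_iff_det_ne_zero b).1 hΩnd
  rw [hC, LinearMap.BilinForm.toMatrix_compLeft, Matrix.det_mul, Matrix.det_transpose,
    LinearMap.det_toMatrix, ← hC, h2] at h1
  rw [h2] at hnz
  have k1 := hBΩ (b 0) (b 1) (b 2) (b 3)
  have k2 := hc (b 0) (b 1) (b 2) (b 3)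
  simp only [wedge22Eval] at k1 k2
  simp only [LinearMap.sub_apply, LinearMap.smul_apply, smul_eq_mul] at h1
  apply mul_right_cancel₀ hnz
  rw [h1, ← mul_pow]
  congr 1
  linear_combination (-lam) * k1 - k2 / 2
end
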